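/- arXiv:2403.19860 — 4 statements merged into one kernel-verified Lean document; each statement's English description precedes it below -/
import Mathlib

section
/- Let μ and ν be probability measures on ℝ, each with mean 0 and finite positive variance. Then their free zero biases coincide, μ° = ν°, if and only if their square biases coincide, μ^□ = ν^□. -/
open MeasureTheory Complex

/-- The Cauchy transform of a measure on ℝ. -/
noncomputable def cauchy (μ : Measure ℝ) (z : ℂ) : ℂ := ∫ t, (z - (t : ℂ))⁻¹ ∂μ

/-- The square bias of a measure on ℝ with finite second moment. -/
noncomputable def sqBias (μ : Measure ℝ) : Measure ℝ :=
  if (∫ t, t ^ 2 ∂μ) = 0 then Measure.dirac 0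
  else μ.withDensity fun t => ENNReal.ofReal (t ^ 2 / ∫ s, s ^ 2 ∂μ)

open Filter Topology in
lemma fzb_kappa_univ : ((volume : Measure ℝ).withDensity
    (fun u => ENNReal.ofReal ((1 + u ^ 2)⁻¹))) Set.univ = ENNReal.ofReal Real.pi := by
  rw [withDensity_apply _ MeasurableSet.univ, Measure.restrict_univ,
    ← ofReal_integral_eq_lintegral_ofReal integrable_inv_one_add_sq
      (Eventually.of_forall fun u => by positivity), integral_univ_inv_one_add_sq]

lemma fzb_ne (z : ℂ) (hz : 0 < z.im) (t : ℝ) : z - (t : ℂ) ≠ 0 := by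
  intro h
  have := congrArg Complex.im h
  simp at this
  exact hz.ne' this

lemma fzb_norm_le (z : ℂ) (hz : 0 < z.im) (t : ℝ) : ‖(z - (t : ℂ))⁻¹‖ ≤ z.im⁻¹ := by
  rw [norm_inv]
  apply inv_anti₀ hz
  have := Complex.abs_im_le_norm (z - (t : ℂ))
  simp at this
  exact (le_abs_self _).trans this

lemma fzb_integrable (μ : Measure ℝ) [IsFiniteMeasure μ] (z : ℂ) (hz : 0 < z.im) :
    Integrable (fun t : ℝ => (z - (t : ℂ))⁻¹) μ := by
  refine Integrable.of_bound (C := z.im⁻¹) ?_ (Filter.Eventually.of_forall (fzb_norm_le z hz))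
  exact (Measurable.inv (by fun_prop)).aestronglyMeasurable

lemma fzb_im (μ : Measure ℝ) [IsFiniteMeasure μ] (z : ℂ) (hz : 0 < z.im) :
    (cauchy μ z).im = ∫ t, ((z - (t : ℂ))⁻¹).im ∂μ := by
  exact (integral_im (fzb_integrable μ z hz)).symm

lemma fzb_im_pt (x y t : ℝ) (hy : 0 < y) :
    (1 + ((x - t) / y) ^ 2)⁻¹ = - y * (((⟨x, y⟩ : ℂ) - (t : ℂ))⁻¹).im := by
  have h1 : (x - t) * (x - t) + y * y ≠ 0 := by
    have := mul_self_nonneg (x - t)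
    positivity
  have h2 : y ^ 2 + (x - t) ^ 2 ≠ 0 := by positivity
  simp [Complex.inv_im, Complex.normSq_apply]
  field_simp
  ring

lemma fzb_lint (μ : Measure ℝ) [IsFiniteMeasure μ] (x y : ℝ) (hy : 0 < y) :
    ∫⁻ t, ENNReal.ofReal ((1 + ((x - t) / y) ^ 2)⁻¹) ∂μ
      = ENNReal.ofReal (- y * (cauchy μ ⟨x, y⟩).im) := by
  rw [fzb_im μ ⟨x, y⟩ hy, ← integral_const_mul, ofReal_integral_eq_lintegral_ofReal]
  · simp_rw [fzb_im_pt x y _ hy]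
  · exact (fzb_integrable μ ⟨x, y⟩ hy).im.const_mul _
  · refine Filter.Eventually.of_forall fun t => ?_
    simp only [Pi.zero_apply]
    rw [← fzb_im_pt x y t hy]
    positivity

lemma fzb_im_neg (μ : Measure ℝ) [IsProbabilityMeasure μ] (z : ℂ) (hz : 0 < z.im) :
    (cauchy μ z).im < 0 := by
  rw [fzb_im μ z hz, ← neg_pos, ← integral_neg]
  have hp : ∀ t : ℝ, 0 < -((z - (t : ℂ))⁻¹).im := by
    intro t
    rw [Complex.inv_im]
    have := Complex.normSq_pos.2 (fzb_ne z hz t)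
    simp only [sub_im, ofReal_im, sub_zero, neg_div, neg_neg]
    positivity
  rw [integral_pos_iff_support_of_nonneg (fun t => (hp t).le) (fzb_integrable μ z hz).im.neg]
  have : Function.support (fun t : ℝ => -((z - (t : ℂ))⁻¹).im) = Set.univ := by
    ext t; simpa using (hp t).ne'
  rw [this]
  simp

open scoped NNReal BoundedContinuousFunction in
lemma fzb_H (μ : Measure ℝ) [IsFiniteMeasure μ] (f : ℝ →ᵇ ℝ≥0) (y : ℝ) (hy : 0 < y) :
    ∫⁻ p, (f (p.1 + y * p.2) : ENNReal) ∂(μ.prod ((volume : Measure ℝ).withDensity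
      (fun u => ENNReal.ofReal ((1 + u ^ 2)⁻¹))))
    = ENNReal.ofReal |y⁻¹| *
      ∫⁻ x, (f x : ENNReal) * ENNReal.ofReal (- y * (cauchy μ ⟨x, y⟩).im) := by
  have hf : Measurable (fun x => (f x : ENNReal)) :=
    (ENNReal.continuous_coe.comp f.continuous).measurable
  have hf2 : Measurable (fun p : ℝ × ℝ => (f (p.1 + y * p.2) : ENNReal)) :=
    hf.comp (by fun_prop)
  rw [lintegral_prod _ hf2.aemeasurable]
  have key : ∀ t : ℝ, ∫⁻ u, (f (t + y * u) : ENNReal) ∂((volume : Measure ℝ).withDensity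
      (fun u => ENNReal.ofReal ((1 + u ^ 2)⁻¹))) = ENNReal.ofReal |y⁻¹| *
      ∫⁻ x, ENNReal.ofReal ((1 + ((x - t) / y) ^ 2)⁻¹) * (f x : ENNReal) := by
    intro t
    have h0 : Measurable (fun u : ℝ => (f (t + y * u) : ENNReal)) := hf.comp (by fun_prop)
    have h2 : Measurable (fun u : ℝ => ENNReal.ofReal ((1 + u ^ 2)⁻¹)) := by fun_prop
    rw [lintegral_withDensity_eq_lintegral_mul _ h2 h0]
    have h1 : Measurable (fun x : ℝ =>
        ENNReal.ofReal ((1 + ((x - t) / y) ^ 2)⁻¹) * (f x : ENNReal)) :=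
      Measurable.mul (by fun_prop) hf
    have h3 : Measurable (fun x : ℝ =>
        ENNReal.ofReal ((1 + ((t + x - t) / y) ^ 2)⁻¹) * (f (t + x) : ENNReal)) :=
      h1.comp (measurable_const_add t)
    rw [← lintegral_add_left_eq_self (fun x : ℝ =>
        ENNReal.ofReal ((1 + ((x - t) / y) ^ 2)⁻¹) * (f x : ENNReal)) t, ← smul_eq_mul (ENNReal.ofReal _),
      ← lintegral_smul_measure, ← Real.map_volume_mul_left hy.ne',
      lintegral_map h3 (measurable_const_mul y)]
    refine lintegral_congr fun u => ?_
    simp [hy.ne']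
  simp_rw [key]
  have hm : Measurable (fun p : ℝ × ℝ =>
      ENNReal.ofReal ((1 + ((p.2 - p.1) / y) ^ 2)⁻¹) * (f p.2 : ENNReal)) :=
    Measurable.mul (by fun_prop) (hf.comp measurable_snd)
  rw [lintegral_const_mul _ hm.lintegral_prod_right', lintegral_lintegral_swap hm.aemeasurable]
  congr 1
  refine lintegral_congr fun x => ?_
  dsimp only
  rw [lintegral_mul_const _ (by fun_prop), fzb_lint μ x y hy, mul_comm]

open Filter Topology in
open scoped NNReal BoundedContinuousFunction in
lemma fzb_tendsto (μ : Measure ℝ) [IsFiniteMeasure μ] (f : ℝ →ᵇ ℝ≥0) :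
    Tendsto (fun n : ℕ => ∫⁻ p, (f (p.1 + (1 / ((n : ℝ) + 1)) * p.2) : ENNReal)
      ∂(μ.prod ((volume : Measure ℝ).withDensity
      (fun u => ENNReal.ofReal ((1 + u ^ 2)⁻¹))))) atTop
      (𝓝 ((∫⁻ t, (f t : ENNReal) ∂μ) * ENNReal.ofReal Real.pi)) := by
  have hf : Measurable (fun x => (f x : ENNReal)) :=
    (ENNReal.continuous_coe.comp f.continuous).measurable
  set κ : Measure ℝ := (volume : Measure ℝ).withDensity
      (fun u => ENNReal.ofReal ((1 + u ^ 2)⁻¹)) with hκ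
  have hκu : κ Set.univ = ENNReal.ofReal Real.pi := fzb_kappa_univ
  have : IsFiniteMeasure κ := ⟨by rw [hκu]; exact ENNReal.ofReal_lt_top⟩
  have hlim : (∫⁻ t, (f t : ENNReal) ∂μ) * ENNReal.ofReal Real.pi
      = ∫⁻ p, (f p.1 : ENNReal) ∂(μ.prod κ) := by
    have hf2 : Measurable (fun p : ℝ × ℝ => (f p.1 : ENNReal)) := hf.comp measurable_fst
    rw [lintegral_prod _ hf2.aemeasurable]
    simp only [lintegral_const]
    rw [lintegral_mul_const _ hf, hκu]
  rw [hlim]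
  refine tendsto_lintegral_of_dominated_convergence (fun _ => ((nndist f 0 : ℝ≥0) : ENNReal))
    (fun n => hf.comp (by fun_prop)) ?_ ?_ ?_
  · intro n
    refine Eventually.of_forall fun p => ?_
    exact ENNReal.coe_le_coe.2 (BoundedContinuousFunction.NNReal.upper_bound f _)
  · rw [lintegral_const]
    exact ENNReal.mul_ne_top ENNReal.coe_ne_top (measure_ne_top _ _)
  · refine Eventually.of_forall fun p => ?_
    refine ENNReal.tendsto_coe.2 ((f.continuous.tendsto _).comp ?_)
    have h := (tendsto_one_div_add_atTop_nhds_zero_nat (𝕜 := ℝ)).mul_const p.2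
    simpa using h.const_add p.1

lemma fzb_inj (μ ν : Measure ℝ) [IsFiniteMeasure μ] [IsFiniteMeasure ν]
    (h : ∀ z : ℂ, 0 < z.im → cauchy μ z = cauchy ν z) : μ = ν := by
  refine ext_of_forall_lintegral_eq_of_IsFiniteMeasure fun f => ?_
  have h1 := fzb_tendsto μ f
  have h2 := fzb_tendsto ν f
  have h3 : ∀ n : ℕ, (0 : ℝ) < 1 / ((n : ℝ) + 1) := fun n => by positivity
  simp_rw [fun n : ℕ => fzb_H μ f _ (h3 n)] at h1
  simp_rw [fun n : ℕ => fzb_H ν f _ (h3 n)] at h2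
  have h4 : ∀ (n : ℕ) (x : ℝ), cauchy μ ⟨x, 1 / ((n : ℝ) + 1)⟩ = cauchy ν ⟨x, 1 / ((n : ℝ) + 1)⟩ :=
    fun n x => h _ (h3 n)
  simp_rw [h4] at h1
  have h5 := tendsto_nhds_unique h1 h2
  exact (ENNReal.mul_left_inj (by simpa using Real.pi_pos) ENNReal.ofReal_ne_top).1 h5

lemma fzb_sq_finite (μ : Measure ℝ) (hμ2 : Integrable (fun t => t ^ 2) μ)
    (hμpos : 0 < ∫ t, t ^ 2 ∂μ) : IsFiniteMeasure (sqBias μ) := by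
  rw [sqBias, if_neg hμpos.ne']
  exact isFiniteMeasure_withDensity_ofReal (hμ2.div_const _).2

lemma fzb_sq (μ : Measure ℝ) [IsProbabilityMeasure μ]
    (hμ1 : Integrable (fun t => t) μ) (hμmean : (∫ t, t ∂μ) = 0)
    (hμ2 : Integrable (fun t => t ^ 2) μ) (hμpos : 0 < ∫ t, t ^ 2 ∂μ) (z : ℂ) (hz : 0 < z.im) :
    (z * cauchy μ z - 1) / ((∫ t, t ^ 2 ∂μ : ℝ) : ℂ) = cauchy (sqBias μ) z / z := by
  have hz0 : z ≠ 0 := by simpa using fzb_ne z hz 0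
  rw [sqBias, if_neg hμpos.ne']
  set s := ∫ t, t ^ 2 ∂μ with hs
  have hs0 : (s : ℂ) ≠ 0 := by exact_mod_cast hμpos.ne'
  have e1 : cauchy (μ.withDensity fun t => ENNReal.ofReal (t ^ 2 / s)) z
      = ∫ t, (s : ℂ)⁻¹ * (z ^ 2 * (z - (t : ℂ))⁻¹ - z - (t : ℂ)) ∂μ := by
    rw [cauchy, integral_withDensity_eq_integral_toReal_smul (by fun_prop)
      (Filter.Eventually.of_forall fun t => ENNReal.ofReal_lt_top)]
    refine integral_congr_ae (Filter.Eventually.of_forall fun t => ?_)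
    have := fzb_ne z hz t
    simp only
    rw [ENNReal.toReal_ofReal (by positivity), Complex.real_smul]
    push_cast
    field_simp
    ring
  have i1 := (fzb_integrable μ z hz).const_mul (z ^ 2)
  have i2 : Integrable (fun t : ℝ => (t : ℂ)) μ := hμ1.ofReal
  have i3 : ∫ t : ℝ, (t : ℂ) ∂μ = 0 := by
    rw [integral_complex_ofReal, hμmean]; simp
  have i4 : Integrable (fun t : ℝ => z ^ 2 * (z - (t : ℂ))⁻¹ - z) μ := i1.sub (integrable_const _)
  rw [e1, integral_const_mul, integral_sub i4 i2,
    integral_sub i1 (integrable_const _), integral_const_mul, i3]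
  simp only [integral_const, probReal_univ, one_smul]
  rw [← cauchy]
  field_simp
  ring

/-- for μ, ν with mean 0 and finite positive variance, with free zero
biases ρμ = μ° and ρν = ν° (characterized by their defining equations), one has
μ° = ν° iff μ^□ = ν^□. -/
theorem freeZeroBias_eq_iff_sqBias_eq (μ ν ρμ ρν : Measure ℝ)
    [IsProbabilityMeasure μ] [IsProbabilityMeasure ν]
    [IsProbabilityMeasure ρμ] [IsProbabilityMeasure ρν]
    (hμ1 : Integrable (fun t => t) μ) (hμmean : (∫ t, t ∂μ) = 0)
    (hμ2 : Integrable (fun t => t ^ 2) μ) (hμpos : 0 < ∫ t, t ^ 2 ∂μ)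
    (hν1 : Integrable (fun t => t) ν) (hνmean : (∫ t, t ∂ν) = 0)
    (hν2 : Integrable (fun t => t ^ 2) ν) (hνpos : 0 < ∫ t, t ^ 2 ∂ν)
    (hρμ : ∀ z : ℂ, 0 < z.im →
      (cauchy ρμ z) ^ 2 = (z * cauchy μ z - 1) / ((∫ t, t ^ 2 ∂μ : ℝ) : ℂ))
    (hρν : ∀ z : ℂ, 0 < z.im →
      (cauchy ρν z) ^ 2 = (z * cauchy ν z - 1) / ((∫ t, t ^ 2 ∂ν : ℝ) : ℂ)) :
    ρμ = ρν ↔ sqBias μ = sqBias ν := by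
  have := fzb_sq_finite μ hμ2 hμpos
  have := fzb_sq_finite ν hν2 hνpos
  constructor
  · intro h
    refine fzb_inj _ _ fun z hz => ?_
    have hz0 : z ≠ 0 := by simpa using fzb_ne z hz 0
    have a := hρμ z hz
    rw [h, hρν z hz, fzb_sq ν hν1 hνmean hν2 hνpos z hz,
      fzb_sq μ hμ1 hμmean hμ2 hμpos z hz] at a
    exact ((div_left_inj' hz0).1 a).symm
  · intro h
    refine fzb_inj _ _ fun z hz => ?_
    have a := hρμ z hz
    have b := hρν z hz
    rw [fzb_sq μ hμ1 hμmean hμ2 hμpos z hz, h] at a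
    rw [fzb_sq ν hν1 hνmean hν2 hνpos z hz, ← a] at b
    rcases sq_eq_sq_iff_eq_or_eq_neg.1 b with c | c
    · exact c.symm
    · have n1 := fzb_im_neg ρμ z hz
      have n2 := fzb_im_neg ρν z hz
      rw [c, Complex.neg_im] at n2
      linarith
end

section
/- Let μ be a probability measure on ℝ with mean 0 and variance σ² ∈ (0,∞), and let μ° be its free zero bias. Then for every Lipschitz function f : ℝ → ℝ, the functional equation ∫ℝ x·f(x) dμ(x) = σ² · ∬_{{(x,y) : x ≠ y}} (f(y) − f(x))/(y − x) d(μ° × μ°)(x,y) holds. (Both integrals are finite: x·f(x) is μ-integrable since μ has a finite second moment, and the difference quotient is bounded by the Lipschitz constant of f; the diagonal {x = y} is (μ°×μ°)-null since μ° has no atoms.) -/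
open MeasureTheory Complex

namespace FZB

noncomputable def kk (y s t : ℝ) : ℝ := y⁻¹ * (1 + ((s - t) / y) ^ 2)⁻¹

lemma kk_nonneg {y : ℝ} (hy : 0 < y) (s t : ℝ) : 0 ≤ kk y s t := by
  unfold kk; positivity

lemma kk_integrable {y : ℝ} (hy : 0 < y) (t : ℝ) : Integrable (fun s => kk y s t) := by
  unfold kk
  exact ((integrable_inv_one_add_sq.comp_div hy.ne').comp_sub_right t).const_mul _

lemma kk_subst {y : ℝ} (hy : 0 < y) (t : ℝ) (f : ℝ → ℝ) :
    ∫ s, f s * kk y s t = ∫ u, f (t + y * u) * (1 + u ^ 2)⁻¹ := by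
  have h := integral_sub_right_eq_self (μ := volume)
    (fun s => f (t + s) * (y⁻¹ * (1 + (s / y) ^ 2)⁻¹)) t
  have h' := Measure.integral_comp_div
    (fun u => f (t + y * u) * (y⁻¹ * (1 + u ^ 2)⁻¹)) y
  have e : ∀ s : ℝ, y * (s / y) = s := fun s => by field_simp
  simp only [add_sub_cancel] at h
  simp only [e] at h'
  unfold kk
  rw [h, h', smul_eq_mul, abs_of_pos hy, ← integral_const_mul]
  congr 1; ext u; field_simp

lemma kk_integral {y : ℝ} (hy : 0 < y) (t : ℝ) : ∫ s, kk y s t = Real.pi := by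
  have := kk_subst hy t (fun _ => 1)
  simpa using this

lemma kk_meas (y : ℝ) : Continuous (fun p : ℝ × ℝ => kk y p.1 p.2) := by
  unfold kk
  refine continuous_const.mul (Continuous.inv₀ (by fun_prop) fun p => by positivity)

lemma kk_prod {Ω : Type*} [MeasurableSpace Ω] (m : Measure Ω) [SFinite m] {y : ℝ} (hy : 0 < y)
    (g h : Ω → ℝ) (hg : Measurable g) (hh : Measurable h) (hi : Integrable h m) :
    Integrable (fun p : ℝ × Ω => h p.2 * kk y p.1 (g p.2)) (volume.prod m) := by
  have hm : Measurable (fun p : ℝ × Ω => h p.2 * kk y p.1 (g p.2)) := by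
    unfold kk
    fun_prop
  rw [integrable_prod_iff' hm.aestronglyMeasurable]
  constructor
  · exact Filter.Eventually.of_forall fun w => (kk_integrable hy (g w)).const_mul (h w)
  · have : ∀ w, ∫ s, ‖h w * kk y s (g w)‖ = |h w| * Real.pi := by
      intro w
      simp only [norm_mul, Real.norm_eq_abs, abs_of_nonneg (kk_nonneg hy _ _)]
      rw [integral_const_mul, kk_integral hy]
    simp only [this]
    exact hi.abs.mul_const _

/-- resolvent -/
noncomputable def rr (y s t : ℝ) : ℂ := (((s : ℂ) + y * I) - (t : ℂ))⁻¹

lemma rr_ne {y : ℝ} (hy : 0 < y) (s t : ℝ) : ((s : ℂ) + y * I) - (t : ℂ) ≠ 0 := by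
  intro h
  have := congrArg Complex.im h
  simp at this
  exact hy.ne' this

lemma rr_im {y : ℝ} (hy : 0 < y) (s t : ℝ) : (rr y s t).im = - kk y s t := by
  unfold rr kk
  rw [Complex.inv_im]
  simp [Complex.normSq_apply]
  have : (s-t)*(s-t)+y*y ≠ 0 := by nlinarith [mul_self_nonneg (s-t), mul_pos hy hy]
  have : y^2 + (s-t)^2 ≠ 0 := by positivity
  field_simp
  ring

lemma rr_normSq {y : ℝ} (hy : 0 < y) (s t : ℝ) : ‖rr y s t‖ ^ 2 = y⁻¹ * kk y s t := by
  unfold rr kk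
  rw [norm_inv, inv_pow, ← Complex.normSq_eq_norm_sq]
  simp [Complex.normSq_apply]
  have : (s-t)*(s-t)+y*y ≠ 0 := by nlinarith [mul_self_nonneg (s-t), mul_pos hy hy]
  have : y^2 + (s-t)^2 ≠ 0 := by positivity
  field_simp
  ring

lemma rr_norm {y : ℝ} (hy : 0 < y) (s t : ℝ) : ‖rr y s t‖ ≤ y⁻¹ := by
  unfold rr
  rw [norm_inv]
  apply inv_anti₀ hy
  have := Complex.abs_im_le_norm (((s : ℂ) + y * I) - (t : ℂ))
  simpa [abs_of_pos hy] using this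

lemma rr_cont {y : ℝ} (hy : 0 < y) : Continuous (fun p : ℝ × ℝ => rr y p.1 p.2) := by
  unfold rr
  exact Continuous.inv₀ (by fun_prop) fun p => rr_ne hy _ _

lemma rr_cont' {y : ℝ} (hy : 0 < y) (s : ℝ) : Continuous (rr y s) :=
  (rr_cont hy).comp (by fun_prop : Continuous fun t : ℝ => (s, t))

lemma rr_int {y : ℝ} (hy : 0 < y) (s : ℝ) (m : Measure ℝ) [IsFiniteMeasure m] :
    Integrable (rr y s) m :=
  Integrable.of_bound (rr_cont' hy s).aestronglyMeasurable y⁻¹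
    (Filter.Eventually.of_forall fun t => rr_norm hy s t)

noncomputable def qq (y s : ℝ) (p : ℝ × ℝ) : ℝ := - (rr y s p.1 * rr y s p.2).im

lemma qq_eq {y : ℝ} (hy : 0 < y) (s : ℝ) (p : ℝ × ℝ) (hp : p.1 ≠ p.2) :
    qq y s p = (kk y s p.2 - kk y s p.1) / (p.2 - p.1) := by
  have h0 : p.2 - p.1 ≠ 0 := sub_ne_zero.2 hp.symm
  rw [eq_div_iff h0]
  have e : rr y s p.1 * rr y s p.2 * ((p.2 - p.1 : ℝ) : ℂ) = rr y s p.2 - rr y s p.1 := by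
    have a := rr_ne hy s p.1
    have b := rr_ne hy s p.2
    unfold rr
    field_simp
    push_cast
    ring
  have := congrArg Complex.im e
  rw [Complex.im_mul_ofReal, Complex.sub_im, rr_im hy, rr_im hy] at this
  unfold qq
  linarith

lemma qq_cont {y : ℝ} (hy : 0 < y) : Continuous (fun p : ℝ × (ℝ × ℝ) => qq y p.1 p.2) := by
  unfold qq
  have := rr_cont hy
  refine (Complex.continuous_im.comp (Continuous.mul ?_ ?_)).neg
  · exact this.comp (by fun_prop : Continuous fun p : ℝ × (ℝ × ℝ) => (p.1, p.2.1))
  · exact this.comp (by fun_prop : Continuous fun p : ℝ × (ℝ × ℝ) => (p.1, p.2.2))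

lemma qq_bound {y : ℝ} (hy : 0 < y) (s : ℝ) (p : ℝ × ℝ) :
    ‖qq y s p‖ ≤ y⁻¹ * (kk y s p.1 + kk y s p.2) := by
  unfold qq
  rw [norm_neg, Real.norm_eq_abs]
  refine (Complex.abs_im_le_norm _).trans ?_
  rw [norm_mul, mul_add, ← rr_normSq hy, ← rr_normSq hy]
  nlinarith [sq_nonneg (‖rr y s p.1‖ - ‖rr y s p.2‖), sq_nonneg (‖rr y s p.1‖ + ‖rr y s p.2‖)]

lemma qq_prod {y : ℝ} (hy : 0 < y) (m : Measure (ℝ × ℝ)) [IsFiniteMeasure m] :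
    Integrable (fun p : ℝ × (ℝ × ℝ) => qq y p.1 p.2) (volume.prod m) := by
  have a := kk_prod m hy Prod.fst (fun _ => 1) measurable_fst measurable_const (integrable_const _)
  have b := kk_prod m hy Prod.snd (fun _ => 1) measurable_snd measurable_const (integrable_const _)
  refine Integrable.mono' ((a.add b).const_mul y⁻¹) (qq_cont hy).aestronglyMeasurable
    (Filter.Eventually.of_forall fun p => ?_)
  simpa using qq_bound hy p.1 p.2

lemma t_rr_int {y : ℝ} (hy : 0 < y) (s : ℝ) (μ : Measure ℝ)
    (h1 : Integrable (fun t => t) μ) : Integrable (fun t : ℝ => (t : ℂ) * rr y s t) μ := by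
  refine Integrable.mul_bdd (c := y⁻¹) h1.ofReal (rr_cont' hy s).aestronglyMeasurable
    (Filter.Eventually.of_forall fun t => rr_norm hy s t)

lemma key0 (μ : Measure ℝ) [IsProbabilityMeasure μ] {y : ℝ} (hy : 0 < y) (s : ℝ) :
    ((s : ℂ) + y * I) * cauchy μ ((s : ℂ) + y * I) - 1 = ∫ t : ℝ, (t : ℂ) * rr y s t ∂μ := by
  unfold cauchy
  have : ∀ t : ℝ, (t : ℂ) * rr y s t = ((s : ℂ) + y * I) * rr y s t - 1 := by
    intro t
    have a := rr_ne hy s t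
    unfold rr
    field_simp
    ring
  simp only [this]
  rw [integral_sub ((rr_int hy s μ).const_mul _) (integrable_const _), integral_const_mul]
  simp [rr]

section main
variable (μ ρ : Measure ℝ)
    [IsProbabilityMeasure μ] [IsProbabilityMeasure ρ]
    (h1 : Integrable (fun t => t) μ) 
    (hpos : 0 < ∫ t, t ^ 2 ∂μ)
    (hρ : ∀ z : ℂ, 0 < z.im →
      (cauchy ρ z) ^ 2 = (z * cauchy μ z - 1) / ((∫ t, t ^ 2 ∂μ : ℝ) : ℂ))
include h1 hpos hρ

lemma key1 {y : ℝ} (hy : 0 < y) (s : ℝ) :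
    ∫ t : ℝ, (t : ℂ) * rr y s t ∂μ = ((∫ t, t ^ 2 ∂μ : ℝ) : ℂ) * (∫ t, rr y s t ∂ρ) ^ 2 := by
  rw [← key0 μ hy]
  have := hρ ((s : ℂ) + y * I) (by simpa using hy)
  have e : cauchy ρ ((s : ℂ) + y * I) = ∫ t, rr y s t ∂ρ := rfl
  rw [← e, this]
  have : ((∫ t, t ^ 2 ∂μ : ℝ) : ℂ) ≠ 0 := by exact_mod_cast hpos.ne'
  field_simp

lemma key2 {y : ℝ} (hy : 0 < y) (s : ℝ) :
    ∫ t : ℝ, t * kk y s t ∂μ = (∫ t, t ^ 2 ∂μ) * ∫ p, qq y s p ∂(ρ.prod ρ) := by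
  have h := key1 μ ρ h1 hpos hρ hy s
  rw [sq, ← integral_prod_mul (μ := ρ) (ν := ρ) (rr y s) (rr y s)] at h
  have h' := congrArg Complex.im h
  rw [Complex.im_ofReal_mul] at h'
  have a := integral_im (𝕜 := ℂ) (t_rr_int hy s μ h1)
  have b := integral_im (𝕜 := ℂ) ((rr_int hy s ρ).mul_prod (rr_int hy s ρ))
  simp only [RCLike.im_to_complex] at a b
  rw [← a, ← b] at h'
  simp only [Complex.im_ofReal_mul, rr_im hy] at h'
  unfold qq
  rw [integral_neg]
  simp only [mul_neg, integral_neg] at h' ⊢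
  linarith

lemma atom (a : ℝ) : ρ {a} = 0 := by
  have key : ∀ y : ℝ, 0 < y → (∫ t, t ^ 2 ∂μ) * (ρ.real {a}) ^ 2 ≤ y * ∫ t, |t| ∂μ := by
    intro y hy
    have h := congrArg norm (key1 μ ρ h1 hpos hρ hy a)
    rw [norm_mul, norm_pow, Complex.norm_real, Real.norm_of_nonneg hpos.le] at h
    have u : ‖∫ t : ℝ, (t : ℂ) * rr y a t ∂μ‖ ≤ y⁻¹ * ∫ t, |t| ∂μ := by
      rw [← integral_const_mul]
      refine norm_integral_le_of_norm_le (h1.abs.const_mul _) (Filter.Eventually.of_forall ?_)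
      intro t
      rw [norm_mul, Complex.norm_real, mul_comm, Real.norm_eq_abs]
      exact mul_le_mul_of_nonneg_right (rr_norm hy a t) (abs_nonneg _)
    have v : y⁻¹ * ρ.real {a} ≤ ‖∫ t, rr y a t ∂ρ‖ := by
      refine le_trans ?_ (Complex.abs_im_le_norm _)
      have b := integral_im (𝕜 := ℂ) (rr_int hy a ρ)
      simp only [RCLike.im_to_complex] at b
      have c := (rr_int hy a ρ).im
      simp only [RCLike.im_to_complex, rr_im hy] at c
      rw [← b]
      simp only [rr_im hy]
      rw [integral_neg, abs_neg]
      refine le_trans ?_ (le_abs_self _)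
      have d : ∫ t in {a}, kk y a t ∂ρ ≤ ∫ t, kk y a t ∂ρ := by
        refine setIntegral_le_integral (by simpa using c.neg)
          (Filter.Eventually.of_forall fun t => kk_nonneg hy _ _)
      rw [integral_singleton] at d
      simpa [kk, mul_comm] using d
    have w : (y⁻¹ * ρ.real {a}) ^ 2 ≤ ‖∫ t, rr y a t ∂ρ‖ ^ 2 := by
      gcongr
    have w' := mul_le_mul_of_nonneg_left w hpos.le
    have : (∫ t, t ^ 2 ∂μ) * (y⁻¹ * ρ.real {a}) ^ 2 ≤ y⁻¹ * ∫ t, |t| ∂μ := by linarith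
    have := mul_le_mul_of_nonneg_left this (sq_nonneg y)
    have e1 : y ^ 2 * ((∫ t, t ^ 2 ∂μ) * (y⁻¹ * ρ.real {a}) ^ 2)
      = (∫ t, t ^ 2 ∂μ) * (ρ.real {a}) ^ 2 := by field_simp
    have e2 : y ^ 2 * (y⁻¹ * ∫ t, |t| ∂μ) = y * ∫ t, |t| ∂μ := by field_simp
    rwa [e1, e2] at this
  have lim : (∫ t, t ^ 2 ∂μ) * (ρ.real {a}) ^ 2 ≤ 0 := by
    have t : Filter.Tendsto (fun y : ℝ => y * ∫ t, |t| ∂μ) (nhdsWithin 0 (Set.Ioi 0)) (nhds 0) := by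
      have : Continuous (fun y : ℝ => y * ∫ t, |t| ∂μ) := by fun_prop
      simpa using (this.tendsto 0).mono_left nhdsWithin_le_nhds
    exact ge_of_tendsto t (by filter_upwards [self_mem_nhdsWithin] with y hy using key y hy)
  have : (ρ.real {a}) ^ 2 ≤ 0 := by
    by_contra hc
    push Not at hc
    nlinarith [mul_pos hpos hc]
  have : ρ.real {a} = 0 := by nlinarith [sq_nonneg (ρ.real {a})]
  simpa [Measure.real, ENNReal.toReal_eq_zero_iff] using this

lemma diag : ∀ᵐ p ∂(ρ.prod ρ), p.1 ≠ p.2 := by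
  have hm : MeasurableSet {p : ℝ × ℝ | p.1 = p.2} := measurableSet_eq_fun measurable_fst measurable_snd
  have : (ρ.prod ρ) {p : ℝ × ℝ | p.1 = p.2} = 0 := by
    rw [Measure.measure_prod_null hm]
    refine Filter.Eventually.of_forall fun x => ?_
    have e : Prod.mk x ⁻¹' {p : ℝ × ℝ | p.1 = p.2} = {x} := by
      ext z; simp [eq_comm]
    simp only [e, Pi.zero_apply]
    exact atom μ ρ h1 hpos hρ x
  rw [ae_iff]
  simpa using this

lemma smooth (f : ℝ → ℝ) (hf : Continuous f) (M : ℝ) (hM : ∀ x, |f x| ≤ M) {y : ℝ} (hy : 0 < y) :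
    ∫ t, t * (∫ s, f s * kk y s t) ∂μ = (∫ t, t ^ 2 ∂μ) *
      ∫ p : ℝ × ℝ, ((∫ s, f s * kk y s p.2) - ∫ s, f s * kk y s p.1) / (p.2 - p.1) ∂(ρ.prod ρ) := by
  have i1 := (kk_prod μ hy (fun t => t) (fun t => t) measurable_id measurable_id h1).bdd_mul (c := M)
    (f := fun p : ℝ × ℝ => f p.1) (by fun_prop) (Filter.Eventually.of_forall fun p => hM p.1)
  have i2 := (qq_prod hy (ρ.prod ρ)).bdd_mul (c := M)
    (f := fun p : ℝ × (ℝ × ℝ) => f p.1) (by fun_prop) (Filter.Eventually.of_forall fun p => hM p.1)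
  have s1 := integral_integral_swap (f := fun s t => f s * (t * kk y s t)) i1
  have s2 := integral_integral_swap (f := fun s p => f s * (qq y s p)) i2
  have L : ∫ t, t * (∫ s, f s * kk y s t) ∂μ = ∫ t, (∫ s, f s * (t * kk y s t)) ∂μ := by
    congr 1; ext t
    rw [← integral_const_mul]
    congr 1; ext s; ring
  have R : ∫ p : ℝ × ℝ, ((∫ s, f s * kk y s p.2) - ∫ s, f s * kk y s p.1) / (p.2 - p.1) ∂(ρ.prod ρ)
      = ∫ p, (∫ s, f s * (qq y s p)) ∂(ρ.prod ρ) := by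
    refine integral_congr_ae ?_
    filter_upwards [diag μ ρ h1 hpos hρ] with p hp
    have fi : ∀ t, Integrable (fun s => f s * kk y s t) := fun t =>
      (kk_integrable hy t).bdd_mul (c := M) (by fun_prop) (Filter.Eventually.of_forall hM)
    rw [← integral_sub (fi _) (fi _), ← integral_div]
    congr 1; ext s
    rw [qq_eq hy s p hp]; ring
  rw [L, R, ← s1, ← s2, ← integral_const_mul]
  congr 1; ext s
  rw [integral_const_mul, integral_const_mul, key2 μ ρ h1 hpos hρ hy]
  ring

lemma bdd (f : ℝ → ℝ) (K : NNReal) (hf : LipschitzWith K f) (M : ℝ) (hM : ∀ x, |f x| ≤ M) :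
    ∫ t, t * f t ∂μ = (∫ t, t ^ 2 ∂μ) *
      ∫ p : ℝ × ℝ, (f p.2 - f p.1) / (p.2 - p.1) ∂(ρ.prod ρ) := by
  have hc := hf.continuous
  set y : ℕ → ℝ := fun n => 1 / ((n : ℝ) + 1) with hy
  have hy0 : ∀ n, 0 < y n := fun n => by simp only [hy]; positivity
  have hyl : Filter.Tendsto y Filter.atTop (nhds 0) := tendsto_one_div_add_atTop_nhds_zero_nat
  set F : ℕ → ℝ → ℝ := fun n t => ∫ u, f (t + y n * u) * (1 + u ^ 2)⁻¹ with hF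
  have hci : Continuous fun u : ℝ => (1 + u ^ 2)⁻¹ :=
    Continuous.inv₀ (by fun_prop) fun p => by positivity
  have fi : ∀ n t, Integrable (fun u => f (t + y n * u) * (1 + u ^ 2)⁻¹) := fun n t =>
      integrable_inv_one_add_sq.bdd_mul (c := M) (by fun_prop) (Filter.Eventually.of_forall fun u => hM _)
  have Flim : ∀ t, Filter.Tendsto (fun n => F n t) Filter.atTop (nhds (f t * Real.pi)) := by
    intro t
    have : f t * Real.pi = ∫ u : ℝ, f t * (1 + u ^ 2)⁻¹ := by
      rw [integral_const_mul, integral_univ_inv_one_add_sq]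
    rw [this]
    refine tendsto_integral_of_dominated_convergence (fun u => M * (1 + u ^ 2)⁻¹)
      (fun n => (fi n t).aestronglyMeasurable) (integrable_inv_one_add_sq.const_mul M) ?_ ?_
    · intro n
      refine Filter.Eventually.of_forall fun u => ?_
      have : 0 ≤ (1 + u ^ 2)⁻¹ := by positivity
      rw [norm_mul, Real.norm_eq_abs, Real.norm_of_nonneg this]
      exact mul_le_mul_of_nonneg_right (hM _) this
    · refine Filter.Eventually.of_forall fun u => ?_
      refine Filter.Tendsto.mul_const _ ?_
      refine (hc.tendsto t).comp ?_
      simpa using (hyl.mul_const u).const_add t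
  have Fb : ∀ n t, |F n t| ≤ M * Real.pi := by
    intro n t
    rw [← integral_univ_inv_one_add_sq, ← integral_const_mul, ← Real.norm_eq_abs]
    simp only [hF]
    refine norm_integral_le_of_norm_le (integrable_inv_one_add_sq.const_mul M)
      (Filter.Eventually.of_forall fun u => ?_)
    have : 0 ≤ (1 + u ^ 2)⁻¹ := by positivity
    rw [norm_mul, Real.norm_eq_abs, Real.norm_of_nonneg this]
    exact mul_le_mul_of_nonneg_right (hM _) this
  have Fl : ∀ n a b, |F n b - F n a| ≤ (K * Real.pi) * |b - a| := by
    intro n a b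
    have e : (K * Real.pi) * |b - a| = ∫ u : ℝ, (K * |b - a|) * (1 + u ^ 2)⁻¹ := by
      rw [integral_const_mul, integral_univ_inv_one_add_sq]; ring
    rw [e, hF]
    simp only
    rw [← integral_sub (fi _ _) (fi _ _), ← Real.norm_eq_abs]
    refine norm_integral_le_of_norm_le (integrable_inv_one_add_sq.const_mul _)
      (Filter.Eventually.of_forall fun u => ?_)
    have : 0 ≤ (1 + u ^ 2)⁻¹ := by positivity
    rw [← sub_mul, norm_mul, Real.norm_of_nonneg this]
    refine mul_le_mul_of_nonneg_right ?_ this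
    have := hf.dist_le_mul (b + y n * u) (a + y n * u)
    simpa [Real.dist_eq] using this
  have Fc : ∀ n, Continuous (F n) := by
    intro n
    refine (LipschitzWith.of_dist_le_mul (K := K * Real.pi.toNNReal) fun b a => ?_).continuous
    simpa [Real.dist_eq, Real.coe_toNNReal _ Real.pi_pos.le] using Fl n a b
  have eqn : ∀ n, ∫ t, t * F n t ∂μ = (∫ t, t ^ 2 ∂μ) *
      ∫ p : ℝ × ℝ, (F n p.2 - F n p.1) / (p.2 - p.1) ∂(ρ.prod ρ) := by
    intro n
    have := smooth μ ρ h1 hpos hρ f hc M hM (hy0 n)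
    simp only [kk_subst (hy0 n)] at this
    exact this
  have l1 : Filter.Tendsto (fun n => ∫ t, t * F n t ∂μ) Filter.atTop
      (nhds (∫ t, t * (f t * Real.pi) ∂μ)) := by
    refine tendsto_integral_of_dominated_convergence (fun t => |t| * (M * Real.pi))
      (fun n => (continuous_id.mul (Fc n)).aestronglyMeasurable) (h1.abs.mul_const _) ?_ ?_
    · intro n
      refine Filter.Eventually.of_forall fun t => ?_
      rw [norm_mul, Real.norm_eq_abs]
      exact mul_le_mul_of_nonneg_left (Fb n t) (abs_nonneg _)
    · exact Filter.Eventually.of_forall fun t => (Flim t).const_mul t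
  have l2 : Filter.Tendsto (fun n => ∫ p : ℝ × ℝ, (F n p.2 - F n p.1) / (p.2 - p.1) ∂(ρ.prod ρ))
      Filter.atTop
      (nhds (∫ p : ℝ × ℝ, (f p.2 * Real.pi - f p.1 * Real.pi) / (p.2 - p.1) ∂(ρ.prod ρ))) := by
    refine tendsto_integral_of_dominated_convergence (fun t => K * Real.pi)
      (fun n => ?_) (integrable_const _) ?_ ?_
    · have := (Fc n).measurable
      exact Measurable.aestronglyMeasurable (by fun_prop)
    · intro n
      refine Filter.Eventually.of_forall fun p => ?_
      rw [norm_div, Real.norm_eq_abs, Real.norm_eq_abs]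
      exact div_le_of_le_mul₀ (abs_nonneg _) (by positivity) (Fl n _ _)
    · exact Filter.Eventually.of_forall fun p => ((Flim _).sub (Flim _)).div_const _
  have l3 := tendsto_nhds_unique l1 (by simpa only [eqn] using l2.const_mul (∫ t, t ^ 2 ∂μ))
  simp only [← mul_assoc, ← sub_mul, mul_div_right_comm, integral_mul_const] at l3
  exact mul_right_cancel₀ Real.pi_ne_zero l3

end main
end FZB

/-- the free zero bias functional equation.  For μ with mean 0 and
variance σ² ∈ (0,∞) and ρ = μ° its free zero bias, for every Lipschitz f : ℝ → ℝ,
∫ x·f(x) dμ = σ² ∬_{x ≠ y} (f(y) − f(x))/(y − x) d(ρ × ρ). -/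
theorem freeZeroBias_functional_equation (μ ρ : Measure ℝ)
    [IsProbabilityMeasure μ] [IsProbabilityMeasure ρ]
    (h1 : Integrable (fun t => t) μ) (hmean : (∫ t, t ∂μ) = 0)
    (h2 : Integrable (fun t => t ^ 2) μ) (hpos : 0 < ∫ t, t ^ 2 ∂μ)
    (hρ : ∀ z : ℂ, 0 < z.im →
      (cauchy ρ z) ^ 2 = (z * cauchy μ z - 1) / ((∫ t, t ^ 2 ∂μ : ℝ) : ℂ)) :
    ∀ f : ℝ → ℝ, (∃ K, LipschitzWith K f) →
      (∫ x, x * f x ∂μ)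
        = (∫ t, t ^ 2 ∂μ) *
          ∫ p in {p : ℝ × ℝ | p.1 ≠ p.2}, (f p.2 - f p.1) / (p.2 - p.1) ∂(ρ.prod ρ) := by
  rintro f ⟨K, hf⟩
  have hr : (ρ.prod ρ).restrict {p : ℝ × ℝ | p.1 ≠ p.2} = ρ.prod ρ :=
    Measure.restrict_eq_self_of_ae_mem (FZB.diag μ ρ h1 hpos hρ)
  rw [hr]
  set F : ℕ → ℝ → ℝ := fun n t => max (min (f t) n) (-n) with hF
  have FL : ∀ n, LipschitzWith K (F n) := fun n => (hf.min_const _).max_const _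
  have Fb : ∀ n t, |F n t| ≤ n := by
    intro n t
    have : (0 : ℝ) ≤ n := n.cast_nonneg
    exact abs_le.2 ⟨le_max_right _ _, max_le (min_le_right _ _) (by linarith)⟩
  have Ff : ∀ n t, |F n t| ≤ |f t| := by
    intro n t
    have : (0 : ℝ) ≤ n := n.cast_nonneg
    refine abs_le.2 ⟨?_, max_le ((min_le_left _ _).trans (le_abs_self _)) ?_⟩
    · refine le_max_of_le_left (le_min (neg_abs_le _) ?_)
      linarith [abs_nonneg (f t)]
    · linarith [abs_nonneg (f t)]
  have Flim : ∀ t, Filter.Tendsto (fun n => F n t) Filter.atTop (nhds (f t)) := by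
    intro t
    refine tendsto_const_nhds.congr' ?_
    obtain ⟨N, hN⟩ := exists_nat_ge |f t|
    filter_upwards [Filter.eventually_ge_atTop N] with n hn
    have h : |f t| ≤ n := hN.trans (by exact_mod_cast hn)
    have := abs_le.1 h
    simp only [hF]
    rw [min_eq_left this.2, max_eq_left this.1]
  have eqn := fun n => FZB.bdd μ ρ h1 hpos hρ (F n) K (FL n) n (Fb n)
  have l1 : Filter.Tendsto (fun n => ∫ t, t * F n t ∂μ) Filter.atTop
      (nhds (∫ t, t * f t ∂μ)) := by
    refine tendsto_integral_of_dominated_convergence (fun t => |t| * |f 0| + K * t ^ 2)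
      (fun n => (continuous_id.mul (FL n).continuous).aestronglyMeasurable)
      ((h1.abs.mul_const _).add (h2.const_mul _)) ?_ ?_
    · intro n
      refine Filter.Eventually.of_forall fun t => ?_
      rw [norm_mul, Real.norm_eq_abs, Real.norm_eq_abs]
      have a := hf.dist_le_mul t 0
      rw [Real.dist_eq, Real.dist_eq, sub_zero] at a
      have b : |f t| ≤ |f 0| + K * |t| := by
        have := abs_sub_abs_le_abs_sub (f t) (f 0)
        linarith
      calc |t| * |F n t| ≤ |t| * (|f 0| + K * |t|) :=
            mul_le_mul_of_nonneg_left ((Ff n t).trans b) (abs_nonneg _)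
        _ = |t| * |f 0| + K * t ^ 2 := by rw [← sq_abs t]; ring
    · exact Filter.Eventually.of_forall fun t => (Flim t).const_mul t
  have l2 : Filter.Tendsto (fun n => ∫ p : ℝ × ℝ, (F n p.2 - F n p.1) / (p.2 - p.1) ∂(ρ.prod ρ))
      Filter.atTop
      (nhds (∫ p : ℝ × ℝ, (f p.2 - f p.1) / (p.2 - p.1) ∂(ρ.prod ρ))) := by
    refine tendsto_integral_of_dominated_convergence (fun t => (K : ℝ))
      (fun n => ?_) (integrable_const _) ?_ ?_
    · have := (FL n).continuous.measurable
      exact Measurable.aestronglyMeasurable (by fun_prop)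
    · intro n
      refine Filter.Eventually.of_forall fun p => ?_
      rw [norm_div, Real.norm_eq_abs, Real.norm_eq_abs]
      refine div_le_of_le_mul₀ (abs_nonneg _) (by positivity) ?_
      have := (FL n).dist_le_mul p.2 p.1
      rwa [Real.dist_eq, Real.dist_eq] at this
    · exact Filter.Eventually.of_forall fun p => ((Flim _).sub (Flim _)).div_const _
  exact tendsto_nhds_unique l1 (by simpa only [eqn] using l2.const_mul (∫ t, t ^ 2 ∂μ))
end

section
/- Let μ be a probability measure on ℝ with mean 0 and variance σ² ∈ (0,∞), and let ν be a probability measure on ℝ satisfying the classical zero bias identity: for every f ∈ C_c^∞(ℝ), ∫ℝ x·f(x) dμ(x) = σ² · ∫ℝ f′(t) dν(t). Then for all real a ≤ b, ν([a,b]) ≤ ((b−a)/σ²)·∫ℝ |x| dμ(x); consequently ν is absolutely continuous with respect to Lebesgue measure. -/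
open MeasureTheory


lemma keyR (μ ν : Measure ℝ)
    [IsProbabilityMeasure μ] [IsProbabilityMeasure ν]
    (h1 : Integrable (fun t => t) μ) (S : ℝ) (hpos : 0 < S)
    (hν : ∀ f : ℝ → ℝ, ContDiff ℝ (⊤ : ℕ∞) f → HasCompactSupport f →
      (∫ x, x * f x ∂μ) = S * ∫ t, deriv f t ∂ν)
    (g : ℝ → ℝ) (hg : ContDiff ℝ (⊤ : ℕ∞) g) (hg0 : ∀ x, 0 ≤ g x) (hgi : Integrable g)
    (M : ℝ) (hM : ∫ x, g x ≤ M) (a b : ℝ) (hab : ∀ x ∈ Set.Icc a b, g x = 1)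
    (χ : ContDiffBump (0:ℝ)) (hχ : χ.rIn = 1) (C : ℝ) (hC : ∀ x, |deriv χ x| ≤ C)
    (R : ℝ) (hR : 0 < R) (hRa : |a| ≤ R) (hRb : |b| ≤ R) :
    (ν (Set.Icc a b)).toReal ≤ (M / S) * ∫ x, |x| ∂μ + M * C * R⁻¹ := by
  set G : ℝ → ℝ := fun x => ∫ t in (0:ℝ)..x, g t with hG
  have hGd : ∀ x, HasDerivAt G (g x) x := fun x =>
    intervalIntegral.integral_hasDerivAt_right (hg.continuous.intervalIntegrable _ _)
      (hg.continuous.stronglyMeasurableAtFilter _ _) hg.continuous.continuousAt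
  have hGc : ContDiff ℝ (⊤ : ℕ∞) G := by
    rw [contDiff_infty_iff_deriv]
    refine ⟨fun x => (hGd x).differentiableAt, ?_⟩
    have : deriv G = g := funext fun x => (hGd x).deriv
    rwa [this]
  have hGM : ∀ x, |G x| ≤ M := by
    intro x
    refine le_trans ?_ hM
    have := intervalIntegral.norm_integral_le_integral_norm_uIoc (f := g) (a := 0) (b := x) (μ := volume)
    rw [Real.norm_eq_abs] at this
    refine this.trans ?_
    have e : (fun t => ‖g t‖) = g := funext fun t => by rw [Real.norm_eq_abs, abs_of_nonneg (hg0 t)]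
    rw [e]
    exact setIntegral_le_integral hgi (Filter.Eventually.of_forall hg0)
  have hM0 : 0 ≤ M := (abs_nonneg _).trans (hGM 0)
  have hC0 : 0 ≤ C := (abs_nonneg _).trans (hC 0)
  set k : ℝ → ℝ := fun x => χ (R⁻¹ * x) with hk
  have hkc : ContDiff ℝ (⊤ : ℕ∞) k := χ.contDiff.comp (contDiff_const.mul contDiff_id)
  have hks : HasCompactSupport k := by
    have := χ.hasCompactSupport.comp_homeomorph (Homeomorph.mulLeft₀ R⁻¹ (by positivity))
    exact this
  have hkd : ∀ x, HasDerivAt k (deriv χ (R⁻¹ * x) * R⁻¹) x := by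
    intro x
    have h := ((χ.contDiff (n := 1)).differentiable (by simp) (R⁻¹ * x)).hasDerivAt
    have h2 : HasDerivAt (fun x : ℝ => R⁻¹ * x) R⁻¹ x := by
      simpa using (hasDerivAt_id x).const_mul R⁻¹
    exact h.comp x h2
  set f : ℝ → ℝ := fun x => G x * k x with hf
  have hfc : ContDiff ℝ (⊤ : ℕ∞) f := hGc.mul hkc
  have hfs : HasCompactSupport f := hks.mul_left
  have hfd : ∀ x, deriv f x = g x * k x + G x * (deriv χ (R⁻¹ * x) * R⁻¹) := fun x =>
    ((hGd x).mul (hkd x)).deriv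
  have key := hν f hfc hfs
  have hk1 : ∀ x, |k x| ≤ 1 := fun x => by
    rw [abs_of_nonneg χ.nonneg]; exact χ.le_one
  have up : ∫ x, x * f x ∂μ ≤ M * ∫ x, |x| ∂μ := by
    rw [← integral_const_mul]
    refine (Real.le_norm_self _).trans ((norm_integral_le_integral_norm _).trans ?_)
    have hfb : ∀ x, |f x| ≤ M := fun x => by
      rw [hf, abs_mul]
      nlinarith [hGM x, hk1 x, abs_nonneg (G x), abs_nonneg (k x)]
    refine integral_mono_of_nonneg (Filter.Eventually.of_forall fun x => norm_nonneg _)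
      (h1.abs.const_mul M) (Filter.Eventually.of_forall fun x => ?_)
    simp only [Real.norm_eq_abs, abs_mul]
    nlinarith [hfb x, abs_nonneg x]
  have lo : (ν (Set.Icc a b)).toReal - M * C * R⁻¹ ≤ ∫ t, deriv f t ∂ν := by
    have e : (ν (Set.Icc a b)).toReal - M * C * R⁻¹
        = ∫ t, ((Set.Icc a b).indicator (fun _ => (1:ℝ)) t - M * C * R⁻¹) ∂ν := by
      rw [integral_sub ((integrable_const _).indicator measurableSet_Icc) (integrable_const _),
        integral_indicator measurableSet_Icc]
      simp [Measure.real]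
    rw [e]
    refine integral_mono (((integrable_const _).indicator measurableSet_Icc).sub (integrable_const _))
      ((hfc.continuous_deriv (by simp)).integrable_of_hasCompactSupport hfs.deriv) fun t => ?_
    simp only []
    rw [hfd]
    have hA : (Set.Icc a b).indicator (fun _ => (1:ℝ)) t ≤ g t * k t := by
      by_cases ht : t ∈ Set.Icc a b
      · rw [Set.indicator_of_mem ht, hab t ht]
        have : k t = 1 := by
          apply χ.one_of_mem_closedBall
          rw [hχ, mem_closedBall_zero_iff, Real.norm_eq_abs, abs_mul, abs_of_pos (inv_pos.2 hR),
            inv_mul_le_iff₀ hR, mul_one, abs_le]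
          rw [abs_le] at hRa hRb
          exact ⟨hRa.1.trans ht.1, ht.2.trans hRb.2⟩
        rw [this]; norm_num
      · rw [Set.indicator_of_notMem ht]
        exact mul_nonneg (hg0 t) χ.nonneg
    have hB : |G t * (deriv χ (R⁻¹ * t) * R⁻¹)| ≤ M * C * R⁻¹ := by
      rw [abs_mul, abs_mul, abs_of_pos (inv_pos.2 hR), ← mul_assoc]
      gcongr
      · exact hGM t
      · exact hC _
    linarith [(abs_le.1 hB).1]
  rw [key] at up
  have : ∫ t, deriv f t ∂ν ≤ M / S * ∫ x, |x| ∂μ := by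
    rw [div_mul_eq_mul_div, le_div_iff₀ hpos]; linarith
  linarith

lemma acK (ν : Measure ℝ) (K : ℝ) (hK : 0 ≤ K)
    (h : ∀ a b : ℝ, a ≤ b → ν (Set.Icc a b) ≤ ENNReal.ofReal (K * (b - a))) : ν ≪ volume := by
  have hle : ν ≤ (K.toNNReal • StieltjesFunction.id).measure := by
    intro s
    have : ν.toOuterMeasure ≤ (K.toNNReal • StieltjesFunction.id).outer := by
      unfold StieltjesFunction.outer
      rw [OuterMeasure.le_ofFunction]
      intro s
      rw [StieltjesFunction.length_eq]
      refine le_iInf fun a => le_iInf fun b => le_iInf fun hs => ?_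
      have hbot : (botSet : Set ℝ) = ∅ := by
        ext x; simp [botSet]
      rw [hbot, Set.diff_empty] at hs
      show ν s ≤ ENNReal.ofReal ((K.toNNReal : ℝ) * b - (K.toNNReal : ℝ) * a)
      rw [Real.coe_toNNReal _ hK, ← mul_sub]
      rcases le_total a b with hab | hab
      · exact (measure_mono (hs.trans Set.Ioc_subset_Icc_self)).trans (h a b hab)
      · rw [Set.Ioc_eq_empty (not_lt.2 hab), Set.subset_empty_iff] at hs
        simp [hs]
    have h2 := this s
    rw [StieltjesFunction.measure]
    exact h2
  rw [StieltjesFunction.measure_smul, ← Real.volume_eq_stieltjes_id] at hle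
  exact (Measure.absolutelyContinuous_of_le hle).trans Measure.smul_absolutelyContinuous

/-- if ν satisfies the classical zero bias identity for μ (mean 0,
variance σ² ∈ (0,∞)), then ν([a,b]) ≤ ((b−a)/σ²)·∫|x| dμ for all a ≤ b, and ν is
absolutely continuous with respect to Lebesgue measure. -/
theorem classical_zero_bias_absolutely_continuous (μ ν : Measure ℝ)
    [IsProbabilityMeasure μ] [IsProbabilityMeasure ν]
    (h1 : Integrable (fun t => t) μ) (hmean : (∫ t, t ∂μ) = 0)
    (h2 : Integrable (fun t => t ^ 2) μ) (hpos : 0 < ∫ t, t ^ 2 ∂μ)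
    (hν : ∀ f : ℝ → ℝ, ContDiff ℝ (⊤ : ℕ∞) f → HasCompactSupport f →
      (∫ x, x * f x ∂μ) = (∫ t, t ^ 2 ∂μ) * ∫ t, deriv f t ∂ν) :
    (∀ a b : ℝ, a ≤ b →
      (ν (Set.Icc a b)).toReal ≤ ((b - a) / ∫ t, t ^ 2 ∂μ) * ∫ x, |x| ∂μ) ∧
    ν ≪ volume := by
  have main : ∀ a b : ℝ, a ≤ b →
      (ν (Set.Icc a b)).toReal ≤ ((b - a) / ∫ t, t ^ 2 ∂μ) * ∫ x, |x| ∂μ := by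
    intro a b hab
    set S := ∫ t, t ^ 2 ∂μ
    let χ : ContDiffBump (0:ℝ) := ⟨1, 2, by norm_num, by norm_num⟩
    obtain ⟨C, hC⟩ := ((χ.contDiff (n := 1)).continuous_deriv (by simp)).bounded_above_of_compact_support
      χ.hasCompactSupport.deriv
    have step : ∀ ε : ℝ, 0 < ε →
        (ν (Set.Icc a b)).toReal ≤ ((b - a + 4 * ε) / S) * ∫ x, |x| ∂μ := by
      intro ε hε
      let g : ContDiffBump ((a + b) / 2) := ⟨(b - a) / 2 + ε, (b - a) / 2 + 2 * ε, by linarith, by linarith⟩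
      have hM : ∫ x, g x ≤ b - a + 4 * ε := by
        refine (g.integral_le_measure_closedBall (μ := volume)).trans ?_
        rw [Measure.real, Real.volume_closedBall, ENNReal.toReal_ofReal]
        · show 2 * ((b - a) / 2 + 2 * ε) ≤ _
          linarith
        · have := g.rOut_pos
          positivity
      have hab1 : ∀ x ∈ Set.Icc a b, g x = 1 := by
        intro x hx
        apply g.one_of_mem_closedBall
        rw [Real.closedBall_eq_Icc]
        show _ ≤ _ ∧ _ ≤ _
        constructor
        · show (a + b) / 2 - ((b - a) / 2 + ε) ≤ x
          linarith [hx.1]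
        · show x ≤ (a + b) / 2 + ((b - a) / 2 + ε)
          linarith [hx.2]
      have hk := keyR μ ν h1 S hpos hν g g.contDiff (fun x => g.nonneg) g.integrable _ hM a b hab1 χ rfl C hC
      have lim : Filter.Tendsto (fun R : ℝ => ((b - a + 4 * ε) / S) * ∫ x, |x| ∂μ + (b - a + 4 * ε) * C * R⁻¹)
          Filter.atTop (nhds (((b - a + 4 * ε) / S) * ∫ x, |x| ∂μ + (b - a + 4 * ε) * C * 0)) :=
        tendsto_const_nhds.add (tendsto_inv_atTop_zero.const_mul _)
      rw [mul_zero, add_zero] at lim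
      refine ge_of_tendsto lim ?_
      filter_upwards [Filter.eventually_gt_atTop 0, Filter.eventually_ge_atTop |a|,
        Filter.eventually_ge_atTop |b|] with R r1 r2 r3
      exact hk R r1 r2 r3
    have cont : Continuous (fun ε : ℝ => ((b - a + 4 * ε) / S) * ∫ x, |x| ∂μ) := by fun_prop
    have lim : Filter.Tendsto (fun ε : ℝ => ((b - a + 4 * ε) / S) * ∫ x, |x| ∂μ)
        (nhdsWithin 0 (Set.Ioi 0)) (nhds (((b - a + 4 * 0) / S) * ∫ x, |x| ∂μ)) :=
      (cont.tendsto 0).mono_left nhdsWithin_le_nhds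
    rw [mul_zero, add_zero] at lim
    refine ge_of_tendsto lim ?_
    filter_upwards [self_mem_nhdsWithin] with ε hε
    exact step ε hε
  refine ⟨main, acK ν ((∫ x, |x| ∂μ) / ∫ t, t ^ 2 ∂μ)
    (div_nonneg (integral_nonneg fun x => abs_nonneg x) hpos.le) fun a b hab => ?_⟩
  rw [ENNReal.le_ofReal_iff_toReal_le (measure_ne_top _ _)]
  · refine (main a b hab).trans (le_of_eq ?_)
    ring
  · exact mul_nonneg (div_nonneg (integral_nonneg fun x => abs_nonneg x) hpos.le) (sub_nonneg.2 hab)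
end

section
/- Let μ be a probability measure on ℝ with mean 0 and variance σ² ∈ (0,∞), and let μ° be its free zero bias. Then: (i) for all real a ≤ b, μ°([a,b])² ≤ ((b−a)/σ²)·∫ℝ |x| dμ(x); (ii) μ° is absolutely continuous with respect to Lebesgue measure; (iii) the support of μ° is contained in the closed convex hull of the support of μ. -/
open MeasureTheory Complex Topology

/-- The (topological) support of a measure on ℝ: the set of points all of whose
neighborhoods have positive measure. -/
def measureSupport (μ : Measure ℝ) : Set ℝ := {x | ∀ U ∈ 𝓝 x, μ U ≠ 0}

theorem ker_norm_le {z : ℂ} (hz : 0 < z.im) (t : ℝ) : ‖(z - (t:ℂ))⁻¹‖ ≤ z.im⁻¹ := by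
  rw [norm_inv]
  apply inv_anti₀ hz
  have := Complex.abs_im_le_norm (z - (t:ℂ))
  simp at this
  exact (le_abs_self _).trans this

theorem ker_meas (z : ℂ) : Measurable (fun t : ℝ => (z - (t:ℂ))⁻¹) := by fun_prop

theorem ker_integrable (μ : Measure ℝ) [IsProbabilityMeasure μ] {z : ℂ} (hz : 0 < z.im) :
    Integrable (fun t : ℝ => (z - (t:ℂ))⁻¹) μ :=
  Integrable.of_bound (ker_meas z).aestronglyMeasurable _ (.of_forall fun t => ker_norm_le hz t)

theorem wker_integrable (μ : Measure ℝ) {f : ℝ → ℝ} (hf : Integrable f μ) {z : ℂ} (hz : 0 < z.im) :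
    Integrable (fun t : ℝ => (f t : ℂ) * (z - (t:ℂ))⁻¹) μ :=
  hf.ofReal.mul_bdd (c := z.im⁻¹) (ker_meas z).aestronglyMeasurable (.of_forall fun t => ker_norm_le hz t)

/-- weighted Cauchy transform -/
noncomputable def wC (μ : Measure ℝ) (f : ℝ → ℝ) (z : ℂ) : ℂ :=
  ∫ t, (f t : ℂ) * (z - (t:ℂ))⁻¹ ∂μ

theorem sub_ne {z : ℂ} (hz : 0 < z.im) (t : ℝ) : z - (t:ℂ) ≠ 0 := by
  intro h
  have := congrArg Complex.im h
  simp at this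
  linarith

theorem w_eq (μ : Measure ℝ) [IsProbabilityMeasure μ] {z : ℂ} (hz : 0 < z.im) :
    z * cauchy μ z - 1 = wC μ (fun t => t) z := by
  have h : ∀ t : ℝ, (t : ℂ) * (z - (t:ℂ))⁻¹ = z * (z - (t:ℂ))⁻¹ - 1 := by
    intro t
    have := sub_ne hz t
    field_simp
    ring
  unfold wC cauchy
  simp_rw [h]
  rw [integral_sub ((ker_integrable μ hz).const_mul z) (integrable_const _), integral_const_mul]
  simp

theorem ker_im (x y t : ℝ) : -((((⟨x, y⟩:ℂ) - (t:ℂ))⁻¹).im) = y / ((x-t)^2+y^2) := by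
  rw [Complex.inv_im, Complex.normSq_apply]
  simp [pow_two, neg_div]

theorem ker_re (x y t : ℝ) : ((((⟨x, y⟩:ℂ) - (t:ℂ))⁻¹).re) = (x-t) / ((x-t)^2+y^2) := by
  rw [Complex.inv_re, Complex.normSq_apply]
  simp [pow_two]

theorem q_eq (ρ : Measure ℝ) [IsProbabilityMeasure ρ] (x : ℝ) {y : ℝ} (hy : 0 < y) :
    -(cauchy ρ ⟨x,y⟩).im = ∫ t, y / ((x-t)^2+y^2) ∂ρ := by
  have hi := ker_integrable ρ (z := ⟨x,y⟩) hy
  have := (integral_im hi)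
  simp only [RCLike.im_to_complex] at this
  unfold cauchy
  rw [← this, ← integral_neg]
  simp_rw [ker_im]

theorem q_int (ρ : Measure ℝ) [IsProbabilityMeasure ρ] (x : ℝ) {y : ℝ} (hy : 0 < y) :
    Integrable (fun t => y / ((x-t)^2+y^2)) ρ := by
  have hi := (ker_integrable ρ (z := ⟨x,y⟩) hy).im.neg
  refine hi.congr (.of_forall fun t => ?_)
  simp only [RCLike.im_to_complex, Pi.neg_apply]
  exact ker_im x y t

theorem q_nonneg (ρ : Measure ℝ) [IsProbabilityMeasure ρ] (x : ℝ) {y : ℝ} (hy : 0 < y) :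
    0 ≤ -(cauchy ρ ⟨x,y⟩).im := by
  rw [q_eq ρ x hy]
  exact integral_nonneg fun t => by positivity

theorem q_lint (ρ : Measure ℝ) [IsProbabilityMeasure ρ] (x : ℝ) {y : ℝ} (hy : 0 < y) :
    ENNReal.ofReal (-(cauchy ρ ⟨x,y⟩).im) = ∫⁻ t, ENNReal.ofReal (y / ((x-t)^2+y^2)) ∂ρ := by
  rw [q_eq ρ x hy, ofReal_integral_eq_lintegral_ofReal (q_int ρ x hy)]
  exact .of_forall fun t => by positivity

theorem q_sq {G w : ℂ} {V : ℝ} (hV : 0 < V) (h : G ^ 2 = w / (V:ℂ)) :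
    (-G.im)^2 = (‖w‖ - w.re) / (2 * V) := by
  have h1 : w = V * G^2 := by
    have : (V:ℂ) ≠ 0 := by exact_mod_cast hV.ne'
    rw [h]; field_simp
  have h2 : ‖w‖ = V * (G.re^2 + G.im^2) := by
    rw [h1, norm_mul, norm_pow, ← Complex.normSq_eq_norm_sq, Complex.normSq_apply]
    simp [abs_of_pos hV]
    left; ring
  have h3 : w.re = V * (G.re^2 - G.im^2) := by
    rw [h1]; simp [pow_two]
  rw [h2, h3]
  field_simp
  ring

theorem smoothing (ρ : Measure ℝ) [IsProbabilityMeasure ρ] {K : Set ℝ} (hK : MeasurableSet K)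
    {y : ℝ} (hy : 0 < y) :
    ρ K ≤ ∫⁻ x in Metric.cthickening y K, ENNReal.ofReal (-(cauchy ρ ⟨x,y⟩).im) := by
  have hm : Measurable (fun p : ℝ × ℝ => ENNReal.ofReal (y / ((p.1-p.2)^2+y^2))) := by fun_prop
  simp_rw [q_lint ρ _ hy]
  rw [lintegral_lintegral_swap hm.aemeasurable]
  calc ρ K = ∫⁻ t in K, 1 ∂ρ := by simp
    _ ≤ ∫⁻ t in K, (∫⁻ x in Metric.cthickening y K, ENNReal.ofReal (y / ((x-t)^2+y^2))) ∂ρ := by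
        apply setLIntegral_mono' hK
        intro t ht
        calc (1:ENNReal) = ∫⁻ x in Set.Icc (t-y) (t+y), ENNReal.ofReal (1/(2*y)) := by
              simp only [lintegral_const, MeasurableSet.univ, Measure.restrict_apply, Set.univ_inter,
                Real.volume_Icc]
              rw [← ENNReal.ofReal_mul (by positivity)]
              rw [show 1/(2*y) * (t + y - (t-y)) = 1 by field_simp; ring]
              simp
          _ ≤ ∫⁻ x in Set.Icc (t-y) (t+y), ENNReal.ofReal (y / ((x-t)^2+y^2)) := by
              apply setLIntegral_mono' measurableSet_Icc
              intro x hx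
              apply ENNReal.ofReal_le_ofReal
              rw [div_le_div_iff₀ (by positivity) (by positivity)]
              nlinarith [hx.1, hx.2]
          _ ≤ _ := by
              apply lintegral_mono_set
              rw [← Real.closedBall_eq_Icc]
              exact Metric.closedBall_subset_cthickening ht y
    _ ≤ _ := setLIntegral_le_lintegral _ _

theorem elem_ineq (n d y : ℝ) (hn : 0 < n) (hy : 0 < y) (h : n^2 = d^2 + y^2) :
    1 / n - d / n^2 ≤ (3 * √3 / 4) / y := by
  have hs : √3 ^ 2 = 3 := Real.sq_sqrt (by norm_num)
  have hs0 : 0 < √3 := by positivity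
  have key : 4 * y * (n - d) ≤ 3 * √3 * n^2 := by
    refine le_of_abs_le (abs_le_of_sq_le_sq ?_ (by positivity))
    have : (4 * y * (n - d))^2 = 16 * (n^2 - d^2) * (n-d)^2 := by rw [h]; ring
    rw [this]
    have : (3 * √3 * n^2)^2 = 27 * n^4 := by
      rw [mul_pow, mul_pow, hs]; ring
    rw [this]
    have : 0 ≤ (2*d+n)^2 * ((2*d-3*n)^2 + 2*n^2) := by positivity
    nlinarith
  rw [show 1 / n - d / n^2 = (n - d) / n^2 by field_simp, div_le_div_iff₀ (by positivity) hy]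
  linarith

theorem ptI (c y t : ℝ) (hy : 0 < y) :
    ‖(t:ℂ) * ((⟨c,y⟩:ℂ) - (t:ℂ))⁻¹‖ - ((t:ℂ) * ((⟨c,y⟩:ℂ) - (t:ℂ))⁻¹).re
      ≤ |t| * ((3 * √3 / 4) / y) := by
  set n := ‖(⟨c,y⟩:ℂ) - (t:ℂ)‖ with hn
  have hn0 : 0 < n := norm_pos_iff.2 (sub_ne hy t)
  have hn2 : n^2 = (c-t)^2 + y^2 := by
    rw [hn, ← Complex.normSq_eq_norm_sq, Complex.normSq_apply]; simp; ring
  rw [Complex.re_ofReal_mul, ker_re, norm_mul, norm_inv, ← hn, ← hn2, Complex.norm_real,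
    Real.norm_eq_abs]
  have e1 := elem_ineq n (c-t) y hn0 hy hn2
  have e2 := elem_ineq n (-(c-t)) y hn0 hy (by rw [hn2]; ring)
  rcases le_total 0 t with h | h
  · rw [abs_of_nonneg h]
    have := mul_le_mul_of_nonneg_left e1 h
    rw [one_div] at this
    linarith
  · rw [abs_of_nonpos h]
    have := mul_le_mul_of_nonneg_left e2 (neg_nonneg.2 h)
    rw [one_div, neg_div] at this
    linarith

theorem wI (μ : Measure ℝ) (h1 : Integrable (fun t => t) μ) (c : ℝ) {y : ℝ} (hy : 0 < y) :
    ‖wC μ (fun t => t) ⟨c,y⟩‖ - (wC μ (fun t => t) ⟨c,y⟩).re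
      ≤ (∫ t, |t| ∂μ) * ((3 * √3 / 4) / y) := by
  have hi := wker_integrable μ h1 (z := ⟨c,y⟩) hy
  have hre := integral_re hi
  simp only [RCLike.re_to_complex] at hre
  have hre' := hi.re
  simp only [RCLike.re_to_complex] at hre'
  unfold wC
  rw [← hre, ← integral_mul_const]
  refine (sub_le_sub_right (norm_integral_le_integral_norm _) _).trans ?_
  rw [← integral_sub hi.norm hre']
  exact integral_mono (hi.norm.sub hre') (h1.abs.mul_const _) fun t => ptI c y t hy

theorem partI_lt (μ ρ : Measure ℝ)
    [IsProbabilityMeasure μ] [IsProbabilityMeasure ρ]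
    (h1 : Integrable (fun t => t) μ) (V : ℝ) (hpos : 0 < V)
    (hρ : ∀ z : ℂ, 0 < z.im →
      (cauchy ρ z) ^ 2 = (z * cauchy μ z - 1) / (V : ℂ)) (a b : ℝ) (hab : a < b) :
    (ρ (Set.Icc a b)).toReal ^ 2 ≤ ((b - a) / V) * ∫ x, |x| ∂μ := by
  have hs : √3 ^ 2 = 3 := Real.sq_sqrt (by norm_num)
  have hs0 : 0 < √3 := by positivity
  obtain ⟨L, hL⟩ : ∃ L, L = (b-a)/2 := ⟨_, rfl⟩
  have hL0 : 0 < L := by linarith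
  obtain ⟨c, hc⟩ : ∃ c, c = (a+b)/2 := ⟨_, rfl⟩
  obtain ⟨y, hyd⟩ : ∃ y, y = √3 * L := ⟨_, rfl⟩
  have hy : 0 < y := by rw [hyd]; positivity
  have hy2 : y^2 = 3 * L^2 := by rw [hyd, mul_pow, hs]
  have hq := q_sq hpos ((hρ ⟨c,y⟩ hy).trans (by rw [w_eq μ hy]))
  have hw := wI μ h1 c hy
  have hlow : (ρ (Set.Icc a b)).toReal * (√3 / (4 * L)) ≤ -(cauchy ρ ⟨c,y⟩).im := by
    rw [q_eq ρ c hy]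
    calc (ρ (Set.Icc a b)).toReal * (√3 / (4 * L)) = ∫ t in Set.Icc a b, √3/(4*L) ∂ρ := by
          simp [Measure.real]
      _ ≤ ∫ t in Set.Icc a b, y / ((c-t)^2+y^2) ∂ρ := by
          apply setIntegral_mono_on (integrable_const _) (q_int ρ c hy).integrableOn measurableSet_Icc
          intro t ht
          have h4 : (c-t)^2 ≤ L^2 := by
            apply sq_le_sq'
            · rw [hc, hL]; linarith [ht.2]
            · rw [hc, hL]; linarith [ht.1]
          rw [div_le_div_iff₀ (by positivity) (by positivity), hy2, hyd]
          have := mul_le_mul_of_nonneg_left h4 hs0.le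
          nlinarith
      _ ≤ _ := setIntegral_le_integral (q_int ρ c hy) (.of_forall fun t => by positivity)
  have hlow2 := pow_le_pow_left₀ (by positivity) hlow 2
  rw [hq, mul_pow, div_pow, hs] at hlow2
  set E := ∫ x, |x| ∂μ
  set R := (ρ (Set.Icc a b)).toReal
  have h5 : (‖wC μ (fun t => t) ⟨c,y⟩‖ - (wC μ (fun t => t) ⟨c,y⟩).re) / (2 * V) ≤
      E * ((3 * √3 / 4) / y) / (2*V) := by gcongr
  have h6 := hlow2.trans h5
  have h7 : E * ((3 * √3 / 4) / y) / (2*V) = E * 3 / (8 * L * V) := by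
    rw [hyd]; field_simp; ring
  rw [h7] at h6
  have h8 : R^2 = R^2 * (3 / (4*L)^2) * ((4*L)^2/3) := by field_simp
  rw [h8]
  calc _ ≤ E * 3 / (8 * L * V) * ((4*L)^2/3) := by gcongr
    _ = _ := by rw [show b - a = 2 * L by rw [hL]; ring]; field_simp; ring

theorem partI (μ ρ : Measure ℝ)
    [IsProbabilityMeasure μ] [IsProbabilityMeasure ρ]
    (h1 : Integrable (fun t => t) μ) (V : ℝ) (hpos : 0 < V)
    (hρ : ∀ z : ℂ, 0 < z.im →
      (cauchy ρ z) ^ 2 = (z * cauchy μ z - 1) / (V : ℂ)) (a b : ℝ) (hab : a ≤ b) :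
    (ρ (Set.Icc a b)).toReal ^ 2 ≤ ((b - a) / V) * ∫ x, |x| ∂μ := by
  have hlim : Filter.Tendsto (fun b' : ℝ => ((b' - a) / V) * ∫ x, |x| ∂μ) (𝓝[>] b)
      (𝓝 (((b - a) / V) * ∫ x, |x| ∂μ)) := by
    apply Filter.Tendsto.mono_left _ nhdsWithin_le_nhds
    apply Continuous.tendsto
    fun_prop
  refine ge_of_tendsto hlim ?_
  filter_upwards [self_mem_nhdsWithin] with b' hb'
  refine le_trans ?_ (partI_lt μ ρ h1 V hpos hρ a b' (hab.trans_lt hb'))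
  gcongr
  · exact measure_ne_top _ _
  · exact le_of_lt hb'

theorem norm_sub_re_le (w : ℂ) (r : ℝ) (hr : 0 ≤ r) : ‖w‖ - w.re ≤ 2 * ‖w - r‖ := by
  have h1 : ‖w‖ ≤ ‖w - r‖ + r := by
    calc ‖w‖ = ‖(w - r) + r‖ := by simp
      _ ≤ ‖w - r‖ + ‖(r:ℂ)‖ := norm_add_le _ _
      _ = _ := by rw [Complex.norm_real, Real.norm_eq_abs, abs_of_nonneg hr]
  have h2 := (abs_le.1 (Complex.abs_re_le_norm (w - r))).1
  simp at h2
  linarith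

theorem wIII (μ : Measure ℝ) [IsProbabilityMeasure μ] (h1 : Integrable (fun t => t) μ)
    (hmean : (∫ t, t ∂μ) = 0)
    (x : ℝ) {y d : ℝ} (hy : 0 < y) (hd : 0 < d)
    (hx : (∀ᵐ t ∂μ, t + d ≤ x) ∨ (∀ᵐ t ∂μ, x + d ≤ t)) :
    ‖wC μ (fun t => t) ⟨x,y⟩‖ - (wC μ (fun t => t) ⟨x,y⟩).re
      ≤ 2 * ((∫ t, |t| ∂μ) * (y / d^2)) := by
  have hdist : ∀ᵐ t ∂μ, d ≤ |x - t| := by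
    rcases hx with hx | hx
    · filter_upwards [hx] with t ht
      exact le_trans (by linarith) (le_abs_self _)
    · filter_upwards [hx] with t ht
      exact le_trans (by linarith) (neg_le_abs _)
  have hsign : ∀ᵐ t ∂μ, 0 < x * (x - t) := by
    rcases hx with hx | hx
    · have : 0 < x := by
        have : (∫ t, t + d ∂μ) ≤ ∫ t, x ∂μ :=
          integral_mono_ae (h1.add (integrable_const _)) (integrable_const _) hx
        rw [integral_add h1 (integrable_const _), hmean] at this
        simp at this
        linarith
      filter_upwards [hx] with t ht
      exact mul_pos this (by linarith)
    · have : x < 0 := by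
        have : (∫ t, x + d ∂μ) ≤ ∫ t, t ∂μ :=
          integral_mono_ae (integrable_const _) h1 hx
        rw [hmean] at this
        simp at this
        linarith
      filter_upwards [hx] with t ht
      exact mul_pos_of_neg_of_neg this (by linarith)
  have hri : Integrable (fun t => t * (x - t)⁻¹) μ := by
    refine h1.mul_bdd (c := d⁻¹) (by fun_prop) ?_
    filter_upwards [hdist] with t ht
    rw [norm_inv]
    exact inv_anti₀ hd ht
  have hr : 0 ≤ ∫ t, t * (x - t)⁻¹ ∂μ := by
    have : ∫ t, t * x⁻¹ ∂μ ≤ ∫ t, t * (x - t)⁻¹ ∂μ := by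
      apply integral_mono_ae (h1.mul_const _) hri
      filter_upwards [hsign] with t ht
      have hx0 : x ≠ 0 := by rintro rfl; simp at ht
      have hxt : x - t ≠ 0 := by intro h; simp [h] at ht
      have : t * (x - t)⁻¹ - t * x⁻¹ = t^2 / (x * (x - t)) := by field_simp; ring
      have h0 : 0 ≤ t^2 / (x * (x - t)) := by positivity
      linarith
    rw [integral_mul_const, hmean] at this
    simpa using this
  refine (norm_sub_re_le _ _ hr).trans ?_
  gcongr
  rw [← integral_complex_ofReal]
  unfold wC
  simp only
  have hri' : Integrable (fun t : ℝ => ((t * (x - t)⁻¹ : ℝ) : ℂ)) μ := hri.ofReal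
  rw [← integral_sub (wker_integrable μ h1 (z := ⟨x,y⟩) hy) hri', ← integral_mul_const]
  apply norm_integral_le_of_norm_le (h1.abs.mul_const _)
  filter_upwards [hdist] with t ht
  have hz := sub_ne (z := ⟨x,y⟩) hy t
  have hxt : x - t ≠ 0 := by intro h; simp [h] at ht; linarith
  have hxt' : (x:ℂ) - t ≠ 0 := by exact_mod_cast hxt
  have hk : (t:ℂ) * ((⟨x,y⟩:ℂ) - t)⁻¹ - ((t * (x-t)⁻¹ : ℝ):ℂ)
      = t * (-(I * y) * (((⟨x,y⟩:ℂ) - t)⁻¹ * ((x:ℂ)-t)⁻¹)) := by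
    have e : (⟨x,y⟩:ℂ) = x + I * y := by apply Complex.ext <;> simp
    rw [e] at hz ⊢
    push_cast
    field_simp
    ring
  have hk2 : d ≤ ‖(⟨x,y⟩:ℂ) - t‖ := by
    have := Complex.abs_re_le_norm ((⟨x,y⟩:ℂ) - t)
    simp at this
    linarith
  have hk3 : ‖(x:ℂ) - t‖ = |x - t| := by
    rw [← Complex.ofReal_sub, Complex.norm_real, Real.norm_eq_abs]
  change ‖(t:ℂ) * ((⟨x,y⟩:ℂ) - t)⁻¹ - ((t * (x-t)⁻¹ : ℝ):ℂ)‖ ≤ _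
  rw [hk]
  simp only [norm_mul, norm_neg, norm_inv, Complex.norm_I, one_mul, Complex.norm_real, hk3,
    Real.norm_eq_abs, abs_of_pos hy]
  rw [div_eq_mul_inv, pow_two, mul_inv]
  gcongr

theorem support_null (μ : Measure ℝ) : μ (measureSupport μ)ᶜ = 0 := by
  apply measure_null_of_locally_null
  intro x hx
  simp only [measureSupport, Set.mem_compl_iff, Set.mem_ofPred_eq, not_forall, not_not] at hx
  obtain ⟨U, hU, h⟩ := hx
  exact ⟨U, mem_nhdsWithin_of_mem_nhds hU, h⟩

theorem partIII (μ ρ : Measure ℝ)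
    [IsProbabilityMeasure μ] [IsProbabilityMeasure ρ]
    (h1 : Integrable (fun t => t) μ) (hmean : (∫ t, t ∂μ) = 0) (V : ℝ) (hpos : 0 < V)
    (hρ : ∀ z : ℂ, 0 < z.im →
      (cauchy ρ z) ^ 2 = (z * cauchy μ z - 1) / (V : ℂ)) :
    measureSupport ρ ⊆ closure (convexHull ℝ (measureSupport μ)) := by
  intro x0 hx0
  by_contra hC
  set C := closure (convexHull ℝ (measureSupport μ)) with hCdef
  have hCc : IsClosed C := isClosed_closure
  have hconv : Convex ℝ C := (convex_convexHull ℝ _).closure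
  have hae : ∀ᵐ t ∂μ, t ∈ C := by
    rw [ae_iff]
    apply measure_mono_null _ (support_null μ)
    intro t ht
    exact fun h => ht (subset_closure (subset_convexHull ℝ _ h))
  obtain ⟨e, he, hball⟩ := Metric.isOpen_iff.1 hCc.isOpen_compl x0 hC
  obtain ⟨d, hd⟩ : ∃ d, d = e / 4 := ⟨_, rfl⟩
  have hd0 : 0 < d := by linarith
  have hfar : ∀ t ∈ C, e ≤ |t - x0| := by
    intro t ht
    by_contra h
    exact hball (by rw [Metric.mem_ball, Real.dist_eq]; linarith) ht
  have hside : (∀ t ∈ C, t + e ≤ x0) ∨ (∀ t ∈ C, x0 + e ≤ t) := by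
    by_cases h : ∃ s ∈ C, x0 ≤ s
    · right
      obtain ⟨s, hs, hxs⟩ := h
      intro t ht
      have := hfar t ht
      rcases le_total t x0 with h | h
      · exact absurd (hconv.ordConnected.out ht hs ⟨h, hxs⟩) hC
      · rw [abs_of_nonneg (by linarith)] at this
        linarith
    · left
      push Not at h
      intro t ht
      have h2 := h t ht
      have := hfar t ht
      rw [abs_of_neg (by linarith)] at this
      linarith
  set E := ∫ t, |t| ∂μ with hE
  have hq : ∀ x, |x - x0| ≤ 2 * d → ∀ y, 0 < y → -(cauchy ρ ⟨x,y⟩).im ≤ √(E / (d^2 * V) * y) := by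
    intro x hx y hy
    have hx' := abs_le.1 hx
    apply Real.le_sqrt_of_sq_le
    rw [q_sq hpos ((hρ ⟨x,y⟩ hy).trans (by rw [w_eq μ hy]))]
    have hw := wIII μ h1 hmean x hy hd0 (by
      rcases hside with h | h
      · left; filter_upwards [hae] with t ht
        have := h t ht; linarith
      · right; filter_upwards [hae] with t ht
        have := h t ht; linarith)
    calc _ ≤ 2 * ((∫ t, |t| ∂μ) * (y / d^2)) / (2 * V) := by gcongr
      _ = _ := by rw [← hE]; field_simp
  have hb : ∀ y, 0 < y → y ≤ d → ρ (Metric.closedBall x0 d) ≤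
      ENNReal.ofReal (√(E / (d^2 * V) * y)) * ENNReal.ofReal (4 * d) := by
    intro y hy hyd
    refine (smoothing ρ Metric.isClosed_closedBall.measurableSet hy).trans ?_
    have hsub : Metric.cthickening y (Metric.closedBall x0 d) ⊆ Metric.closedBall x0 (2*d) := by
      rw [cthickening_closedBall hy.le hd0.le]
      exact Metric.closedBall_subset_closedBall (by linarith)
    refine (lintegral_mono_set hsub).trans ?_
    calc _ ≤ ∫⁻ x in Metric.closedBall x0 (2*d), ENNReal.ofReal (√(E / (d^2 * V) * y)) := by
          apply setLIntegral_mono' Metric.isClosed_closedBall.measurableSet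
          intro x hx
          apply ENNReal.ofReal_le_ofReal
          exact hq x (by simpa [Real.dist_eq] using hx) y hy
      _ = _ := by
          rw [lintegral_const, Measure.restrict_apply MeasurableSet.univ, Set.univ_inter,
            Real.volume_closedBall]
          congr 2; ring
  have hlim : Filter.Tendsto (fun y : ℝ => ENNReal.ofReal (√(E / (d^2 * V) * y)) *
      ENNReal.ofReal (4 * d)) (𝓝[>] 0) (𝓝 0) := by
    have h : Filter.Tendsto (fun y : ℝ => ENNReal.ofReal (√(E / (d^2 * V) * y))) (𝓝[>] 0) (𝓝 0) := by
      apply Filter.Tendsto.mono_left _ nhdsWithin_le_nhds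
      have : Continuous (fun y : ℝ => ENNReal.ofReal (√(E / (d^2 * V) * y))) :=
        ENNReal.continuous_ofReal.comp (by fun_prop)
      simpa using this.tendsto 0
    simpa only [zero_mul] using ENNReal.Tendsto.mul_const h (Or.inr (ENNReal.ofReal_ne_top (r := 4 * d)))
  have hz : ρ (Metric.closedBall x0 d) ≤ 0 := by
    refine ge_of_tendsto hlim ?_
    filter_upwards [Ioo_mem_nhdsGT hd0] with y hy
    exact hb y hy.1 hy.2.le
  exact hx0 _ (Metric.closedBall_mem_nhds x0 hd0) (le_antisymm hz (zero_le))

theorem wC_diff (μ : Measure ℝ) {f : ℝ → ℝ} (hf : Integrable f μ) {z : ℂ} (hz : 0 < z.im) :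
    DifferentiableAt ℂ (wC μ f) z := by
  have hopen : IsOpen {u : ℂ | z.im / 2 < u.im} := isOpen_lt continuous_const Complex.continuous_im
  have hs : {u : ℂ | z.im / 2 < u.im} ∈ 𝓝 z := hopen.mem_nhds (by
    change z.im / 2 < z.im
    linarith)
  have := hasDerivAt_integral_of_dominated_loc_of_deriv_le (μ := μ) (𝕜 := ℂ)
    (F := fun u t => (f t : ℂ) * (u - (t:ℂ))⁻¹)
    (F' := fun u t => (f t : ℂ) * (-1 / (u - (t:ℂ))^2)) (x₀ := z)
    (bound := fun t => ‖f t‖ * ((z.im/2)⁻¹)^2) hs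
    (by
      filter_upwards with u
      exact hf.ofReal.aestronglyMeasurable.mul (ker_meas u).aestronglyMeasurable)
    (wker_integrable μ hf hz)
    (by
      refine hf.ofReal.aestronglyMeasurable.mul ?_
      have : Measurable fun t : ℝ => -1 / (z - (t:ℂ))^2 := by fun_prop
      exact this.aestronglyMeasurable)
    (by
      filter_upwards with t u hu
      have hu' : z.im / 2 < u.im := hu
      have hu0 : 0 < u.im := by linarith
      rw [norm_mul, Complex.norm_real, div_eq_mul_inv, norm_mul, ← inv_pow, norm_pow]
      simp only [norm_neg, norm_one, one_mul]
      gcongr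
      refine (ker_norm_le hu0 t).trans ?_
      gcongr)
    (hf.norm.mul_const _)
    (by
      filter_upwards with t u hu
      have hu' : z.im / 2 < u.im := hu
      have hu0 : 0 < u.im := by linarith
      exact (((hasDerivAt_id u).sub_const (t:ℂ)).inv (sub_ne hu0 t)).const_mul _)
  exact this.2.differentiableAt

theorem wC_norm_le (μ : Measure ℝ) {f : ℝ → ℝ} (hf : Integrable f μ) (h0 : ∀ t, 0 ≤ f t)
    {z : ℂ} (hz : 0 < z.im) : ‖wC μ f z‖ ≤ (∫ t, f t ∂μ) * z.im⁻¹ := by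
  unfold wC
  rw [← integral_mul_const]
  apply norm_integral_le_of_norm_le (hf.mul_const _)
  filter_upwards with t
  rw [norm_mul, Complex.norm_real, Real.norm_eq_abs, abs_of_nonneg (h0 t)]
  exact mul_le_mul_of_nonneg_left (ker_norm_le hz t) (h0 t)

theorem wC_im (μ : Measure ℝ) {f : ℝ → ℝ} (hf : Integrable f μ) (h0 : ∀ t, 0 ≤ f t)
    {z : ℂ} (hz : 0 < z.im) : (wC μ f z).im ≤ 0 := by
  have := integral_im (wker_integrable μ hf hz)
  simp only [RCLike.im_to_complex] at this
  unfold wC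
  rw [← this]
  apply integral_nonpos
  intro t
  change ((f t : ℂ) * (z - (t:ℂ))⁻¹).im ≤ 0
  rw [Complex.im_ofReal_mul]
  have h := ker_im z.re z.im t
  have h2 : 0 ≤ z.im / ((z.re-t)^2+z.im^2) := by positivity
  exact mul_nonpos_of_nonneg_of_nonpos (h0 t) (by linarith)

theorem re_cpow (u : ℂ) (hu : 0 < u.re) :
    Real.cos (3 * Real.pi / 8) * ‖u‖ ^ (3/4 : ℝ) ≤ (u ^ ((3/4 : ℝ) : ℂ)).re := by
  have h := Complex.abs_arg_le_pi_div_two_iff.2 hu.le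
  rw [Complex.cpow_ofReal_re, mul_comm]
  gcongr
  rw [← Real.cos_abs (u.arg * _), abs_mul, abs_of_pos (show (0:ℝ) < 3/4 by norm_num)]
  apply Real.cos_le_cos_of_nonneg_of_le_pi
  · positivity
  · linarith [Real.pi_pos]
  · linarith

theorem kolmogorov (μ : Measure ℝ) {f : ℝ → ℝ} (hf : Integrable f μ) (h0 : ∀ t, 0 ≤ f t)
    (a b : ℝ) (hab : a ≤ b) : ∃ C : ℝ, ∀ y : ℝ, 0 < y → y ≤ 1 →
      ∫ x in a..b, ‖wC μ f ⟨x, y⟩‖ ^ (3/4 : ℝ) ≤ C := by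
  set c0 := Real.cos (3 * Real.pi / 8) with hc0
  have hc0p : 0 < c0 := by
    apply Real.cos_pos_of_mem_Ioo
    constructor <;> linarith [Real.pi_pos]
  obtain ⟨M, hM⟩ : ∃ M, M = ∫ t, f t ∂μ := ⟨_, rfl⟩
  have hM0 : 0 ≤ M := by rw [hM]; exact integral_nonneg h0
  refine ⟨(1 + M) * (b - a + 8) / c0, fun y hy hy1 => ?_⟩
  let u : ℂ → ℂ := fun z => 1 + I * wC μ f z
  let h : ℂ → ℂ := fun z => (u z) ^ ((3/4 : ℝ) : ℂ)
  have hure : ∀ z : ℂ, 0 < z.im → 1 ≤ (u z).re := by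
    intro z hz
    have := wC_im μ hf h0 hz
    simp [u]
    linarith
  have hud : ∀ z : ℂ, 0 < z.im → DifferentiableAt ℂ u z := fun z hz =>
    ((wC_diff μ hf hz).const_mul I).const_add 1
  have hhd : ∀ z : ℂ, 0 < z.im → DifferentiableAt ℂ h z := fun z hz =>
    (hud z hz).cpow_const (Or.inl (by linarith [hure z hz]))
  have hlow : ∀ z : ℂ, 0 < z.im → ‖wC μ f z‖ ≤ ‖u z‖ := by
    intro z hz
    have := wC_im μ hf h0 hz
    apply le_of_abs_le
    apply abs_le_of_sq_le_sq _ (norm_nonneg _)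
    rw [← Complex.normSq_eq_norm_sq, ← Complex.normSq_eq_norm_sq, Complex.normSq_apply,
      Complex.normSq_apply]
    simp [u]
    nlinarith
  have hhn : ∀ z : ℂ, 0 < z.im → z.im ≤ 1 → ‖h z‖ ≤ (1 + M) * z.im ^ (-(3/4) : ℝ) := by
    intro z hz hz1
    have h1 : ‖h z‖ = ‖u z‖ ^ (3/4 : ℝ) :=
      Complex.norm_cpow_real _ _
    have h2 : ‖u z‖ ≤ (1 + M) * z.im⁻¹ := by
      calc ‖u z‖ ≤ ‖(1:ℂ)‖ + ‖I * wC μ f z‖ := norm_add_le _ _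
        _ ≤ z.im⁻¹ + M * z.im⁻¹ := by
            rw [norm_one, norm_mul, Complex.norm_I, one_mul]
            have e1 := wC_norm_le μ hf h0 hz
            rw [← hM] at e1
            have e2 := (one_le_inv₀ hz).2 hz1
            linarith
        _ = _ := by ring
    rw [h1]
    calc ‖u z‖ ^ (3/4 : ℝ) ≤ ((1 + M) * z.im⁻¹) ^ (3/4 : ℝ) := by gcongr
      _ = (1 + M) ^ (3/4 : ℝ) * z.im ^ (-(3/4) : ℝ) := by
          rw [Real.mul_rpow (by positivity) (by positivity), Real.rpow_neg hz.le,
            Real.inv_rpow hz.le]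
      _ ≤ _ := by
          gcongr
          exact Real.rpow_le_self_of_one_le (by linarith) (by norm_num)
  -- the four sides
  have hrect := Complex.integral_boundary_rect_eq_zero_of_differentiableOn h ⟨a, y⟩ ⟨b, 1⟩ (by
    intro z hz
    apply (hhd z _).differentiableWithinAt
    have := (Complex.mem_reProdIm.1 hz).2
    rw [Set.uIcc_of_le hy1] at this
    exact hy.trans_le this.1)
  simp only at hrect
  have htop : ‖∫ x : ℝ in a..b, h (x + (1:ℝ) * I)‖ ≤ (1 + M) * (b - a) := by
    have := intervalIntegral.norm_integral_le_of_norm_le_const (a := a) (b := b) (C := 1 + M)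
      (f := fun x : ℝ => h (x + (1:ℝ) * I)) (by
        intro x _
        have := hhn (x + (1:ℝ) * I) (by simp) (by simp)
        simpa using this)
    rwa [abs_of_nonneg (by linarith)] at this
  have hside : ∀ c : ℝ, ‖∫ s : ℝ in y..1, h (c + s * I)‖ ≤ (1 + M) * 4 := by
    intro c
    have hint : IntervalIntegrable (fun s : ℝ => (1 + M) * s ^ (-(3/4) : ℝ)) volume y 1 :=
      (intervalIntegral.intervalIntegrable_rpow' (by norm_num)).const_mul _
    refine (intervalIntegral.norm_integral_le_of_norm_le hy1 (.of_forall ?_) hint).trans ?_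
    · intro s hs
      have hs0 : 0 < s := hy.trans hs.1
      have := hhn (c + s * I) (by simpa using hs0) (by simpa using hs.2)
      simpa using this
    · rw [intervalIntegral.integral_const_mul, integral_rpow (Or.inl (by norm_num))]
      gcongr
      have : 0 ≤ y ^ (1/4 : ℝ) := by positivity
      norm_num
      linarith
  have hbot : ‖∫ x : ℝ in a..b, h (x + y * I)‖ ≤ (1 + M) * (b - a + 8) := by
    have e : (∫ x : ℝ in a..b, h (x + y * I)) = (∫ x : ℝ in a..b, h (x + (1:ℝ) * I)) +
        (I • (∫ s : ℝ in y..1, h (a + s * I)) - I • (∫ s : ℝ in y..1, h (b + s * I))) := by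
      linear_combination hrect
    rw [e]
    refine (norm_add_le _ _).trans ?_
    refine (add_le_add_right (norm_sub_le _ _) _).trans ?_
    rw [norm_smul, norm_smul, Complex.norm_I, one_mul, one_mul]
    linarith [hside a, hside b]
  have hpt : ∀ x : ℝ, ((x:ℂ) + y * I) = ⟨x, y⟩ := fun x => by apply Complex.ext <;> simp
  simp_rw [hpt] at hbot
  have hc : Continuous (fun x : ℝ => (⟨x, y⟩ : ℂ)) := by
    simp_rw [← hpt]; fun_prop
  have hch : Continuous (fun x : ℝ => h ⟨x, y⟩) := by
    rw [continuous_iff_continuousAt]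
    intro x
    exact ContinuousAt.comp (f := fun x : ℝ => (⟨x, y⟩ : ℂ)) (hhd ⟨x,y⟩ hy).continuousAt hc.continuousAt
  have hcw : Continuous (fun x : ℝ => ‖wC μ f ⟨x, y⟩‖ ^ (3/4 : ℝ)) := by
    refine Continuous.rpow_const ?_ (fun _ => Or.inr (by norm_num))
    apply Continuous.norm
    rw [continuous_iff_continuousAt]
    intro x
    exact ContinuousAt.comp (f := fun x : ℝ => (⟨x, y⟩ : ℂ)) (wC_diff μ hf (z := ⟨x,y⟩) hy).continuousAt hc.continuousAt
  rw [le_div_iff₀' hc0p, ← intervalIntegral.integral_const_mul]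
  refine le_trans ?_ hbot
  refine le_trans ?_ (Complex.re_le_norm _)
  have hre : (∫ x : ℝ in a..b, h ⟨x, y⟩).re = ∫ x : ℝ in a..b, (h ⟨x, y⟩).re := by
    have := Complex.reCLM.intervalIntegral_comp_comm (hch.intervalIntegrable (μ := volume) a b)
    simpa using this.symm
  rw [hre]
  apply intervalIntegral.integral_mono_on hab
  · exact (hcw.const_mul c0).intervalIntegrable a b
  · exact (Complex.continuous_re.comp hch).intervalIntegrable a b
  · intro x _
    refine le_trans ?_ (re_cpow (u ⟨x,y⟩) (by linarith [hure ⟨x,y⟩ hy]))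
    gcongr
    exact hlow ⟨x,y⟩ hy

theorem wC_cont (μ : Measure ℝ) {f : ℝ → ℝ} (hf : Integrable f μ) {y : ℝ} (hy : 0 < y) :
    Continuous (fun x : ℝ => ‖wC μ f ⟨x, y⟩‖ ^ (3/4 : ℝ)) := by
  have hpt : ∀ x : ℝ, ((x:ℂ) + y * I) = ⟨x, y⟩ := fun x => by apply Complex.ext <;> simp
  have hc : Continuous (fun x : ℝ => (⟨x, y⟩ : ℂ)) := by
    simp_rw [← hpt]; fun_prop
  refine Continuous.rpow_const ?_ (fun _ => Or.inr (by norm_num))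
  apply Continuous.norm
  rw [continuous_iff_continuousAt]
  intro x
  exact ContinuousAt.comp (f := fun x : ℝ => (⟨x, y⟩ : ℂ)) (wC_diff μ hf (z := ⟨x,y⟩) hy).continuousAt hc.continuousAt

theorem young (q l : ℝ) (hq : 0 ≤ q) (hl : 0 < l) :
    q ≤ l + l ^ (-(1/2) : ℝ) * (q^2) ^ (3/4 : ℝ) := by
  rcases le_total q l with h | h
  · have : 0 ≤ l ^ (-(1/2) : ℝ) * (q^2) ^ (3/4 : ℝ) := by positivity
    linarith
  · have hq0 : 0 < q := hl.trans_le h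
    have e : q ^ (-(1/2) : ℝ) * (q^2) ^ (3/4 : ℝ) = q := by
      rw [← Real.rpow_natCast, ← Real.rpow_mul hq, ← Real.rpow_add hq0]
      norm_num
    have e2 : q ^ (-(1/2) : ℝ) ≤ l ^ (-(1/2) : ℝ) :=
      Real.rpow_le_rpow_of_nonpos hl h (by norm_num)
    have := mul_le_mul_of_nonneg_right e2 (show 0 ≤ (q^2) ^ (3/4 : ℝ) by positivity)
    linarith

theorem partII (μ ρ : Measure ℝ)
    [IsProbabilityMeasure μ] [IsProbabilityMeasure ρ]
    (h1 : Integrable (fun t => t) μ) (V : ℝ) (hpos : 0 < V)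
    (hρ : ∀ z : ℂ, 0 < z.im →
      (cauchy ρ z) ^ 2 = (z * cauchy μ z - 1) / (V : ℂ)) :
    ρ ≪ volume := by
  have hcomp : ∀ K : Set ℝ, IsCompact K → volume K = 0 → ρ K = 0 := by
    intro K hK hK0
    let fp : ℝ → ℝ := fun t => max t 0
    let fm : ℝ → ℝ := fun t => max (-t) 0
    have hfp : Integrable fp μ := h1.pos_part
    have hfm : Integrable fm μ := h1.neg_part
    obtain ⟨R, hR⟩ := (hK.isBounded.cthickening (δ := 1)).subset_closedBall 0
    rw [Real.closedBall_eq_Icc] at hR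
    obtain ⟨a, ha⟩ : ∃ a, a = 0 - |R| := ⟨_, rfl⟩
    obtain ⟨b, hb⟩ : ∃ b, b = 0 + |R| := ⟨_, rfl⟩
    have hab : a ≤ b := by rw [ha, hb]; linarith [abs_nonneg R]
    have hR' : Metric.cthickening 1 K ⊆ Set.Icc a b := hR.trans
      (Set.Icc_subset_Icc (by rw [ha]; linarith [le_abs_self R]) (by rw [hb]; linarith [le_abs_self R]))
    obtain ⟨Cp, hCp⟩ := kolmogorov μ hfp (fun t => le_max_right _ _) a b hab
    obtain ⟨Cm, hCm⟩ := kolmogorov μ hfm (fun t => le_max_right _ _) a b hab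
    let g : ℝ → ℝ → ℝ := fun y x => V⁻¹ ^ (3/4 : ℝ) *
      (‖wC μ fp ⟨x,y⟩‖ ^ (3/4 : ℝ) + ‖wC μ fm ⟨x,y⟩‖ ^ (3/4 : ℝ))
    have hg0 : ∀ y x, 0 ≤ g y x := fun y x => by positivity
    have hgc : ∀ y, 0 < y → Continuous (g y) := fun y hy =>
      ((wC_cont μ hfp hy).add (wC_cont μ hfm hy)).const_mul _
    have hgi : ∀ y, 0 < y → y ≤ 1 → ∫ x in a..b, g y x ≤ V⁻¹ ^ (3/4 : ℝ) * (Cp + Cm) := by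
      intro y hy hy1
      simp only [g]
      rw [intervalIntegral.integral_const_mul, intervalIntegral.integral_add
        ((wC_cont μ hfp hy).intervalIntegrable a b) ((wC_cont μ hfm hy).intervalIntegrable a b)]
      gcongr
      · exact hCp y hy hy1
      · exact hCm y hy hy1
    have hqg : ∀ x y, 0 < y → ((-(cauchy ρ ⟨x,y⟩).im)^2) ^ (3/4 : ℝ) ≤ g y x := by
      intro x y hy
      have hw : wC μ (fun t => t) ⟨x,y⟩ = wC μ fp ⟨x,y⟩ - wC μ fm ⟨x,y⟩ := by
        unfold wC
        rw [← integral_sub (wker_integrable μ hfp hy) (wker_integrable μ hfm hy)]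
        congr 1
        ext t
        rw [← sub_mul, ← Complex.ofReal_sub]
        congr 2
        simp only [fp, fm]
        rcases le_total 0 t with h | h
        · rw [max_eq_left h, max_eq_right (by linarith)]; ring
        · rw [max_eq_right h, max_eq_left (by linarith)]; ring
      have hq := q_sq hpos ((hρ ⟨x,y⟩ hy).trans (by rw [w_eq μ hy]))
      have hle : (-(cauchy ρ ⟨x,y⟩).im)^2 ≤ V⁻¹ * (‖wC μ fp ⟨x,y⟩‖ + ‖wC μ fm ⟨x,y⟩‖) := by
        rw [hq]
        have e1 := (abs_le.1 (Complex.abs_re_le_norm (wC μ (fun t => t) ⟨x,y⟩))).1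
        have e2 : ‖wC μ (fun t => t) ⟨x,y⟩‖ ≤ ‖wC μ fp ⟨x,y⟩‖ + ‖wC μ fm ⟨x,y⟩‖ := by
          rw [hw]; exact norm_sub_le _ _
        rw [div_le_iff₀ (by positivity)]
        field_simp
        linarith
      calc _ ≤ (V⁻¹ * (‖wC μ fp ⟨x,y⟩‖ + ‖wC μ fm ⟨x,y⟩‖)) ^ (3/4 : ℝ) := by gcongr
        _ = V⁻¹ ^ (3/4 : ℝ) * (‖wC μ fp ⟨x,y⟩‖ + ‖wC μ fm ⟨x,y⟩‖) ^ (3/4 : ℝ) :=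
            Real.mul_rpow (by positivity) (by positivity)
        _ ≤ _ := by
            simp only [g]
            gcongr
            exact Real.rpow_add_le_add_rpow (norm_nonneg _) (norm_nonneg _) (by norm_num) (by norm_num)
    obtain ⟨D, hD⟩ : ∃ D, D = V⁻¹ ^ (3/4 : ℝ) * (Cp + Cm) := ⟨_, rfl⟩
    have hmain : ∀ l : ℝ, 0 < l → ∀ y, 0 < y → y ≤ 1 →
        ρ K ≤ ENNReal.ofReal l * volume (Metric.cthickening y K)
          + ENNReal.ofReal (l ^ (-(1/2) : ℝ) * D) := by
      intro l hl y hy hy1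
      have hsub : Metric.cthickening y K ⊆ Set.Icc a b :=
        (Metric.cthickening_mono hy1 K).trans hR'
      refine (smoothing ρ hK.isClosed.measurableSet hy).trans ?_
      calc _ ≤ ∫⁻ x in Metric.cthickening y K,
            (ENNReal.ofReal l + ENNReal.ofReal (l ^ (-(1/2) : ℝ) * g y x)) := by
            apply lintegral_mono
            intro x
            have e := young _ l (q_nonneg ρ x hy) hl
            have e2 := mul_le_mul_of_nonneg_left (hqg x y hy)
              (show 0 ≤ l ^ (-(1/2) : ℝ) by positivity)
            refine (ENNReal.ofReal_le_ofReal (e.trans (add_le_add_right e2 l))).trans ?_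
            exact ENNReal.ofReal_add_le
        _ = ENNReal.ofReal l * volume (Metric.cthickening y K) +
            ∫⁻ x in Metric.cthickening y K, ENNReal.ofReal (l ^ (-(1/2) : ℝ) * g y x) := by
            rw [lintegral_add_left measurable_const, setLIntegral_const]
        _ ≤ ENNReal.ofReal l * volume (Metric.cthickening y K) +
            ∫⁻ x in Set.Icc a b, ENNReal.ofReal (l ^ (-(1/2) : ℝ) * g y x) := by
            gcongr
        _ ≤ _ := by
            gcongr
            rw [← ofReal_integral_eq_lintegral_ofReal]
            · apply ENNReal.ofReal_le_ofReal
              rw [integral_Icc_eq_integral_Ioc, ← intervalIntegral.integral_of_le hab,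
                intervalIntegral.integral_const_mul, hD]
              gcongr
              exact hgi y hy hy1
            · exact ((hgc y hy).const_mul _).integrableOn_Icc
            · exact .of_forall fun x => mul_nonneg (by positivity) (hg0 y x)
    have hmain2 : ∀ l : ℝ, 0 < l → ρ K ≤ ENNReal.ofReal (l ^ (-(1/2) : ℝ) * D) := by
      intro l hl
      have ht := tendsto_measure_cthickening_of_isCompact (μ := (volume : Measure ℝ)) hK
      rw [hK0] at ht
      have ht2 := (ENNReal.Tendsto.const_mul (a := ENNReal.ofReal l) ht
        (Or.inr ENNReal.ofReal_ne_top)).add_const (ENNReal.ofReal (l ^ (-(1/2) : ℝ) * D))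
      rw [mul_zero, zero_add] at ht2
      refine ge_of_tendsto (ht2.mono_left (nhdsWithin_le_nhds (s := Set.Ioi 0))) ?_
      filter_upwards [Ioo_mem_nhdsGT (zero_lt_one (α := ℝ))] with y hy
      exact hmain l hl y hy.1 hy.2.le
    have hlim : Filter.Tendsto (fun l : ℝ => ENNReal.ofReal (l ^ (-(1/2) : ℝ) * D))
        Filter.atTop (𝓝 0) := by
      have := ENNReal.tendsto_ofReal ((tendsto_rpow_neg_atTop (y := 1/2) (by norm_num)).mul_const D)
      simpa using this
    refine le_antisymm (ge_of_tendsto hlim ?_) zero_le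
    filter_upwards [Filter.eventually_gt_atTop 0] with l hl
    exact hmain2 l hl
  refine Measure.AbsolutelyContinuous.mk fun s hs hs0 => ?_
  rw [hs.measure_eq_iSup_isCompact]
  simp only [ENNReal.iSup_eq_zero]
  intro K hKs hK
  exact hcomp K hK (measure_mono_null hKs hs0)

/-- for μ with mean 0, variance σ² ∈ (0,∞), and ρ = μ° its free zero bias:
(i) ρ([a,b])² ≤ ((b−a)/σ²)·∫|x| dμ; (ii) ρ is absolutely continuous w.r.t. Lebesgue
measure; (iii) the support of ρ is contained in the closed convex hull of the
support of μ. -/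
theorem freeZeroBias_absolutely_continuous (μ ρ : Measure ℝ)
    [IsProbabilityMeasure μ] [IsProbabilityMeasure ρ]
    (h1 : Integrable (fun t => t) μ) (hmean : (∫ t, t ∂μ) = 0)
    (h2 : Integrable (fun t => t ^ 2) μ) (hpos : 0 < ∫ t, t ^ 2 ∂μ)
    (hρ : ∀ z : ℂ, 0 < z.im →
      (cauchy ρ z) ^ 2 = (z * cauchy μ z - 1) / ((∫ t, t ^ 2 ∂μ : ℝ) : ℂ)) :
    (∀ a b : ℝ, a ≤ b →
      (ρ (Set.Icc a b)).toReal ^ 2 ≤ ((b - a) / ∫ t, t ^ 2 ∂μ) * ∫ x, |x| ∂μ) ∧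
    ρ ≪ volume ∧
    measureSupport ρ ⊆ closure (convexHull ℝ (measureSupport μ)) := by
  exact ⟨partI μ ρ h1 _ hpos hρ, partII μ ρ h1 _ hpos hρ, partIII μ ρ h1 hmean _ hpos hρ⟩
end
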